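/- As holomorphic functions on ℍ×ℂ, 12·E_{4,1}(τ,z) = E₄(τ)φ_{0,1}(τ,z) − E₆(τ)φ_{−2,1}(τ,z). -/

import Mathlib

noncomputable section

open Complex

namespace JacobiPaper

/-- `e2 w = e^{2 π i w}`. -/
def e2 (w : ℂ) : ℂ := Complex.exp (2 * (Real.pi : ℂ) * Complex.I * w)

/-- `q = e^{2 π i τ}`. -/
def qC (τ : ℂ) : ℂ := e2 τ

/-- `ζ = e^{2 π i z}`. -/
def zetaC (z : ℂ) : ℂ := e2 z

/-- The Dedekind eta function `η(τ) = q^{1/24} ∏_{n ≥ 1} (1 - qⁿ)`. -/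
def eta (τ : ℂ) : ℂ :=
  Complex.exp ((Real.pi : ℂ) * Complex.I * τ / 12) * ∏' n : ℕ, (1 - qC τ ^ (n + 1))

/-- The odd Jacobi theta function
`ϑ(τ,z) = q^{1/8} (ζ^{1/2} - ζ^{-1/2}) ∏_{n ≥ 1} (1 - qⁿζ)(1 - qⁿζ⁻¹)(1 - qⁿ)`. -/
def theta (τ z : ℂ) : ℂ :=
  Complex.exp ((Real.pi : ℂ) * Complex.I * τ / 4) *
    (Complex.exp ((Real.pi : ℂ) * Complex.I * z) - Complex.exp (-((Real.pi : ℂ) * Complex.I * z))) *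
    ∏' n : ℕ,
      ((1 - qC τ ^ (n + 1) * zetaC z) * (1 - qC τ ^ (n + 1) * (zetaC z)⁻¹) * (1 - qC τ ^ (n + 1)))

/-- `ϑ₀₀(τ,z) = Σ_{n ∈ ℤ} q^{n²/2} ζⁿ`. -/
def theta00 (τ z : ℂ) : ℂ :=
  ∑' n : ℤ, Complex.exp ((Real.pi : ℂ) * Complex.I * (n : ℂ) ^ 2 * τ +
    2 * (Real.pi : ℂ) * Complex.I * (n : ℂ) * z)

/-- `ϑ₀₁(τ,z) = Σ_{n ∈ ℤ} (-1)ⁿ q^{n²/2} ζⁿ`. -/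
def theta01 (τ z : ℂ) : ℂ :=
  ∑' n : ℤ, (-1 : ℂ) ^ n * Complex.exp ((Real.pi : ℂ) * Complex.I * (n : ℂ) ^ 2 * τ +
    2 * (Real.pi : ℂ) * Complex.I * (n : ℂ) * z)

/-- `ϑ₁₀(τ,z) = q^{1/8} ζ^{1/2} Σ_{n ∈ ℤ} q^{n(n+1)/2} ζⁿ`. -/
def theta10 (τ z : ℂ) : ℂ :=
  Complex.exp ((Real.pi : ℂ) * Complex.I * τ / 4) * Complex.exp ((Real.pi : ℂ) * Complex.I * z) *
    ∑' n : ℤ, Complex.exp ((Real.pi : ℂ) * Complex.I * (n : ℂ) * ((n : ℂ) + 1) * τ +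
      2 * (Real.pi : ℂ) * Complex.I * (n : ℂ) * z)

/-- `ξ₀₀(τ,z) = ϑ₀₀(τ,z)/ϑ₀₀(τ,0)`. -/
def xi00 (τ z : ℂ) : ℂ := theta00 τ z / theta00 τ 0

/-- `ξ₀₁(τ,z) = ϑ₀₁(τ,z)/ϑ₀₁(τ,0)`. -/
def xi01 (τ z : ℂ) : ℂ := theta01 τ z / theta01 τ 0

/-- `ξ₁₀(τ,z) = ϑ₁₀(τ,z)/ϑ₁₀(τ,0)`. -/
def xi10 (τ z : ℂ) : ℂ := theta10 τ z / theta10 τ 0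

/-- The weak Jacobi form `φ_{0,1} = 4(ξ₀₀² + ξ₀₁² + ξ₁₀²)`. -/
def phi01 (τ z : ℂ) : ℂ := 4 * (xi00 τ z ^ 2 + xi01 τ z ^ 2 + xi10 τ z ^ 2)

/-- The weak Jacobi form `φ_{0,2}(τ,z) = 2(ξ₀₀ + ξ₀₁ + ξ₁₀)(τ,2z)`. -/
def phi02 (τ z : ℂ) : ℂ := 2 * (xi00 τ (2 * z) + xi01 τ (2 * z) + xi10 τ (2 * z))

/-- The weak Jacobi form `φ_{0,3}(τ,z) = ϑ(τ,2z)²/ϑ(τ,z)²`. -/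
def phi03 (τ z : ℂ) : ℂ := theta τ (2 * z) ^ 2 / theta τ z ^ 2

/-- The weak Jacobi form `φ_{0,4}(τ,z) = ϑ(τ,3z)/ϑ(τ,z)`. -/
def phi04 (τ z : ℂ) : ℂ := theta τ (3 * z) / theta τ z

/-- The weak Jacobi form `φ_{-2,1}(τ,z) = ϑ(τ,z)²/η(τ)⁶`. -/
def phiM21 (τ z : ℂ) : ℂ := theta τ z ^ 2 / eta τ ^ 6

/-- The divisor power sum `σ_k(n)`. -/
def sigma' (k n : ℕ) : ℕ := ∑ d ∈ n.divisors, d ^ k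

/-- The normalized Eisenstein series `E_k(τ) = 1 - (2k/B_k) Σ_{n ≥ 1} σ_{k-1}(n) qⁿ`. -/
def Eis (k : ℕ) (τ : ℂ) : ℂ :=
  1 - (2 * (k : ℂ) / ((bernoulli k : ℚ) : ℂ)) *
    ∑' n : ℕ, (sigma' (k - 1) (n + 1) : ℂ) * qC τ ^ (n + 1)

/-- The discriminant cusp form `Δ = η²⁴`. -/
def Delta (τ : ℂ) : ℂ := eta τ ^ 24

/-- The modular invariant `j = E₄³/Δ`. -/
def jInv (τ : ℂ) : ℂ := Eis 4 τ ^ 3 / Delta τ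

/-- A choice of `(a, b)` with `a d - b c = 1` completing a coprime pair `(c, d)` to a matrix
`(a b; c d) ∈ SL₂(ℤ)`. -/
def bezout (c d : ℤ) : ℤ × ℤ :=
  haveI : Decidable (∃ ab : ℤ × ℤ, ab.1 * d - ab.2 * c = 1) := Classical.propDecidable _
  if h : ∃ ab : ℤ × ℤ, ab.1 * d - ab.2 * c = 1 then h.choose else 0

/-- The summand `(cτ+d)^{-k} Σ_{l ∈ ℤ} e^{2πim(l²(aτ+b)/(cτ+d) + 2lz/(cτ+d) - cz²/(cτ+d))}`
of the Jacobi–Eisenstein series attached to a coprime pair `(c,d)`; it does not depend on the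
choice of `(a,b)` completing `(c,d)` to an element of `SL₂(ℤ)`. -/
def EisJSummand (k m : ℕ) (τ z : ℂ) (c d : ℤ) : ℂ :=
  ((c : ℂ) * τ + (d : ℂ)) ^ (-(k : ℤ)) *
    ∑' l : ℤ, e2 ((m : ℂ) * ((l : ℂ) ^ 2 * (((bezout c d).1 : ℂ) * τ + ((bezout c d).2 : ℂ)) /
        ((c : ℂ) * τ + (d : ℂ)) +
      2 * (l : ℂ) * z / ((c : ℂ) * τ + (d : ℂ)) - (c : ℂ) * z ^ 2 / ((c : ℂ) * τ + (d : ℂ))))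

/-- The Jacobi–Eisenstein series `E_{k,m}` of weight `k` and index `m`. -/
def EisJ (k m : ℕ) (τ z : ℂ) : ℂ :=
  (1 / 2) * ∑' p : {p : ℤ × ℤ // IsCoprime p.1 p.2}, EisJSummand k m τ z p.1.1 p.1.2

/-- `F_{6,3} = (1/2)(E_{6,1} φ_{0,2} - E₆ φ_{0,3})`. -/
def F63 (τ z : ℂ) : ℂ := (1 / 2) * (EisJ 6 1 τ z * phi02 τ z - Eis 6 τ * phi03 τ z)

/-- A weak Jacobi form of weight `k ∈ ℤ` and index `m ∈ ℕ`: a holomorphic function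
`φ : ℍ × ℂ → ℂ` satisfying the two Jacobi transformation laws and having a Fourier expansion
`φ(τ,z) = Σ_{n ≥ 0, l ∈ ℤ} f(n,l) qⁿ ζˡ`. -/
def IsWeakJacobiForm (k : ℤ) (m : ℕ) (φ : ℂ → ℂ → ℂ) (f : ℕ → ℤ → ℂ) : Prop :=
  DifferentiableOn ℂ (fun p : ℂ × ℂ => φ p.1 p.2) {p : ℂ × ℂ | 0 < p.1.im} ∧
  (∀ a b c d : ℤ, a * d - b * c = 1 → ∀ τ z : ℂ, 0 < τ.im →
    φ (((a : ℂ) * τ + (b : ℂ)) / ((c : ℂ) * τ + (d : ℂ))) (z / ((c : ℂ) * τ + (d : ℂ))) =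
      ((c : ℂ) * τ + (d : ℂ)) ^ k *
        e2 ((m : ℂ) * ((c : ℂ) * z ^ 2 / ((c : ℂ) * τ + (d : ℂ)))) * φ τ z) ∧
  (∀ x y : ℤ, ∀ τ z : ℂ, 0 < τ.im →
    φ τ (z + (x : ℂ) * τ + (y : ℂ)) =
      e2 (-(m : ℂ) * ((x : ℂ) ^ 2 * τ + 2 * (x : ℂ) * z)) * φ τ z) ∧
  (∀ τ z : ℂ, 0 < τ.im →
    HasSum (fun p : ℕ × ℤ => f p.1 p.2 * e2 ((p.1 : ℂ) * τ + (p.2 : ℂ) * z)) (φ τ z))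

/-- A weakly holomorphic Jacobi form of weight `0` and index `m ∈ ℕ`: as a weak Jacobi form,
but the Fourier expansion `φ(τ,z) = Σ_{n ≥ n₀, l ∈ ℤ} f(n,l) qⁿ ζˡ` may contain finitely many
negative powers of `q`. -/
def IsWeaklyHolomorphicJacobiForm0 (m : ℕ) (φ : ℂ → ℂ → ℂ) (f : ℤ → ℤ → ℂ) : Prop :=
  DifferentiableOn ℂ (fun p : ℂ × ℂ => φ p.1 p.2) {p : ℂ × ℂ | 0 < p.1.im} ∧
  (∀ a b c d : ℤ, a * d - b * c = 1 → ∀ τ z : ℂ, 0 < τ.im →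
    φ (((a : ℂ) * τ + (b : ℂ)) / ((c : ℂ) * τ + (d : ℂ))) (z / ((c : ℂ) * τ + (d : ℂ))) =
      e2 ((m : ℂ) * ((c : ℂ) * z ^ 2 / ((c : ℂ) * τ + (d : ℂ)))) * φ τ z) ∧
  (∀ x y : ℤ, ∀ τ z : ℂ, 0 < τ.im →
    φ τ (z + (x : ℂ) * τ + (y : ℂ)) =
      e2 (-(m : ℂ) * ((x : ℂ) ^ 2 * τ + 2 * (x : ℂ) * z)) * φ τ z) ∧
  (∃ n₀ : ℤ, ∀ n : ℤ, n < n₀ → ∀ l : ℤ, f n l = 0) ∧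
  (∀ τ z : ℂ, 0 < τ.im →
    HasSum (fun p : ℤ × ℤ => f p.1 p.2 * e2 ((p.1 : ℂ) * τ + (p.2 : ℂ) * z)) (φ τ z))

/-- A function `φ` on `ℍ × ℂ` has integral Fourier coefficients if it is the sum of a Fourier
series `Σ_{n ≥ 0, l ∈ ℤ} f(n,l) qⁿ ζˡ` with all `f(n,l) ∈ ℤ`. -/
def HasIntegralFourierExpansion (φ : ℂ → ℂ → ℂ) : Prop :=
  ∃ f : ℕ → ℤ → ℤ, ∀ τ z : ℂ, 0 < τ.im →
    HasSum (fun p : ℕ × ℤ => (f p.1 p.2 : ℂ) * e2 ((p.1 : ℂ) * τ + (p.2 : ℂ) * z)) (φ τ z)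

lemma e2_add (a b : ℂ) : e2 (a + b) = e2 a * e2 b := by
  rw [e2, e2, e2, ← Complex.exp_add]; ring_nf

lemma e2_neg (a : ℂ) : e2 (-a) = (e2 a)⁻¹ := by
  rw [e2, e2, ← Complex.exp_neg]; ring_nf

lemma e2_sub (a b : ℂ) : e2 (a - b) = e2 a / e2 b := by
  rw [sub_eq_add_neg, e2_add, e2_neg, div_eq_mul_inv]

@[simp] lemma e2_zero : e2 0 = 1 := by simp [e2]

lemma e2_ne_zero (a : ℂ) : e2 a ≠ 0 := Complex.exp_ne_zero _

lemma e2_int (n : ℤ) : e2 n = 1 := by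
  rw [e2, Complex.exp_eq_one_iff]; exact ⟨n, by ring⟩

lemma e2_add_int (a : ℂ) (n : ℤ) : e2 (a + n) = e2 a := by rw [e2_add, e2_int, mul_one]

@[simp] lemma e2_one : e2 1 = 1 := by simpa using e2_int 1

lemma e2_nat_mul (n : ℕ) (a : ℂ) : e2 (n * a) = e2 a ^ n := by
  rw [e2, e2, ← Complex.exp_nat_mul]; ring_nf

lemma norm_e2 (a : ℂ) : ‖e2 a‖ = Real.exp (-(2 * Real.pi * a.im)) := by
  rw [e2, Complex.norm_exp]; simp

@[fun_prop] lemma differentiable_e2 : Differentiable ℂ e2 := by unfold e2; fun_prop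

@[fun_prop] lemma continuous_e2 : Continuous e2 := differentiable_e2.continuous

/-- The `n`-th Fourier coefficient of the restriction of `f` to the real line. -/
def realFourierCoeff (f : ℂ → ℂ) (n : ℤ) : ℂ := ∫ x in (0 : ℝ)..1, f x * e2 (-(n * x))

lemma realFourierCoeff_linearComb {f g : ℂ → ℂ} (hf : Continuous f) (hg : Continuous g)
    (a b : ℂ) (n : ℤ) :
    realFourierCoeff (fun z => a * f z + b * g z) n =
      a * realFourierCoeff f n + b * realFourierCoeff g n := by
  unfold realFourierCoeff
  rw [← intervalIntegral.integral_const_mul, ← intervalIntegral.integral_const_mul,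
    ← intervalIntegral.integral_add]
  · congr 1; ext x; ring
  all_goals exact Continuous.intervalIntegrable (by fun_prop) _ _

/-- The mean of a periodic entire function over a period does not depend on the line. -/
lemma integral_add_eq_of_periodic {g : ℂ → ℂ} (hg : Differentiable ℂ g)
    (hper : ∀ z, g (z + 1) = g z) (τ : ℂ) :
    ∫ x in (0 : ℝ)..1, g (x + τ) = ∫ x in (0 : ℝ)..1, g x := by
  have hrect := Complex.integral_boundary_rect_eq_zero_of_differentiableOn g 0 (1 + τ.im * I)
    hg.differentiableOn
  simp only [zero_re, zero_im, add_re, one_re, mul_re, ofReal_re, I_re, mul_zero, ofReal_im, I_im,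
    mul_one, sub_self, add_zero, add_im, one_im, mul_im, zero_add, ofReal_zero, zero_mul,
    ofReal_one] at hrect
  have hside : ∀ y : ℝ, g (1 + y * I) = g (y * I) := fun y => by rw [add_comm, hper]
  simp only [hside, smul_eq_mul] at hrect
  have hP : Function.Periodic (fun x : ℝ => g (x + τ.im * I)) 1 := fun x => by
    have := hper (x + τ.im * I)
    simpa [add_right_comm] using this
  have hshift := hP.intervalIntegral_add_eq τ.re 0
  have htrans : ∫ x in (0 : ℝ)..1, g (x + τ) =
      ∫ x in τ.re..(τ.re + 1), g (x + τ.im * I) := by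
    have := intervalIntegral.integral_comp_add_right (a := 0) (b := 1)
      (fun x : ℝ => g (x + τ.im * I)) τ.re
    rw [zero_add, add_comm 1] at this
    rw [← this]
    congr 1; ext x
    congr 1
    conv_lhs => rw [← Complex.re_add_im τ]
    push_cast; ring
  rw [htrans, hshift, zero_add]
  linear_combination -hrect

/-- An entire `1`-periodic function all of whose Fourier coefficients vanish is zero. -/
lemma eq_zero_of_realFourierCoeff_eq_zero {f : ℂ → ℂ} (hf : Differentiable ℂ f)
    (hper : ∀ z, f (z + 1) = f z) (h : ∀ n, realFourierCoeff f n = 0) : f = 0 := by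
  have hP : Function.Periodic (fun x : ℝ => f x) 1 := fun x => by simpa using hper x
  let F : C(AddCircle (1 : ℝ), ℂ) :=
    ⟨hP.lift, continuous_coinduced_dom.mpr (hf.continuous.comp Complex.continuous_ofReal)⟩
  have hFx : ∀ x : ℝ, F (x : AddCircle (1 : ℝ)) = f x := fun x => rfl
  clear_value F
  have hF : ∀ n, fourierCoeff F n = 0 := fun n => by
    rw [fourierCoeff_eq_intervalIntegral F n 0, zero_add, ← h n]
    simp only [div_one, one_smul, realFourierCoeff]
    congr 1; ext x
    rw [fourier_coe_apply]
    rw [hFx, smul_eq_mul, mul_comm, e2]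
    congr 2
    push_cast; ring
  have hsum := hasSum_fourier_series_of_summable (f := F) (by simp [funext hF])
  have hF0 : F = 0 := by
    refine hsum.unique ((hasSum_zero (β := ℤ)).congr_fun ?_)
    intro n
    rw [hF]; ext x; simp
  have hreal : ∀ x : ℝ, f x = 0 := fun x => by
    have := DFunLike.congr_fun hF0 (x : AddCircle (1 : ℝ))
    rwa [hFx] at this
  refine AnalyticOnNhd.eq_of_frequently_eq (𝕜 := ℂ) (z₀ := 0)
    (fun z _ => hf.analyticAt z) (fun z _ => analyticAt_const) ?_
  have hseq : Filter.Tendsto (fun n : ℕ => ((1 / ((n : ℝ) + 1) : ℝ) : ℂ)) Filter.atTop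
      (nhdsWithin 0 {0}ᶜ) := by
    refine tendsto_nhdsWithin_iff.mpr ⟨?_, Filter.Eventually.of_forall fun n => ?_⟩
    · exact (Complex.continuous_ofReal.tendsto' 0 0 rfl).comp
        tendsto_one_div_add_atTop_nhds_zero_nat
    · simp only [Set.mem_compl_iff, Set.mem_singleton_iff, ofReal_eq_zero]
      positivity
  exact hseq.frequently (Filter.Frequently.of_forall fun n => hreal _)

/-- Entire functions with the quasi-periodicity of a theta function of degree `m`. -/
structure IsThetaFunction (τ : ℂ) (m : ℕ) (C : ℂ) (f : ℂ → ℂ) : Prop where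
  differentiable : Differentiable ℂ f
  add_one : ∀ z, f (z + 1) = f z
  add_period : ∀ z, f (z + τ) = C * e2 (-(m * z)) * f z

namespace IsThetaFunction

variable {τ C : ℂ} {m : ℕ} {f g u v : ℂ → ℂ}

lemma linearComb (hf : IsThetaFunction τ m C f) (hg : IsThetaFunction τ m C g) (a b : ℂ) :
    IsThetaFunction τ m C (fun z => a * f z + b * g z) where
  differentiable := (hf.differentiable.const_mul a).add (hg.differentiable.const_mul b)
  add_one z := by rw [hf.add_one, hg.add_one]
  add_period z := by rw [hf.add_period, hg.add_period]; ring

lemma realFourierCoeff_add (hf : IsThetaFunction τ m C f) (n : ℤ) :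
    C * realFourierCoeff f (n + m) = e2 (n * τ) * realFourierCoeff f n := by
  have h := integral_add_eq_of_periodic (g := fun z => f z * e2 (-(n * z)))
    (hf.differentiable.mul (by fun_prop)) (fun z => by
      rw [hf.add_one, mul_add, neg_add, mul_one, ← Int.cast_neg, e2_add_int]) τ
  unfold realFourierCoeff
  rw [← h, ← intervalIntegral.integral_const_mul, ← intervalIntegral.integral_const_mul]
  congr 1; ext x
  rw [hf.add_period]
  have h1 : e2 (-((n + m : ℤ) * (x : ℂ))) = e2 (-(m * x)) * e2 (-(n * x)) := by
    rw [← e2_add]; congr 1; push_cast; ring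
  have h2 : e2 (-(n * (x + τ))) = e2 (-(n * x)) * (e2 (n * τ))⁻¹ := by
    rw [← e2_neg, ← e2_add]; congr 1; ring
  rw [h1, h2]
  have := e2_ne_zero (n * τ)
  field_simp

/-- A theta function of degree `m` is determined by `m` consecutive Fourier coefficients. -/
lemma eq_zero (hf : IsThetaFunction τ m C f) (hC : C ≠ 0) (hm : 0 < m)
    (h : ∀ i : ℕ, i < m → realFourierCoeff f i = 0) : f = 0 := by
  refine eq_zero_of_realFourierCoeff_eq_zero hf.differentiable hf.add_one fun n => ?_
  have hstep : ∀ n : ℤ, realFourierCoeff f (n + m) = 0 ↔ realFourierCoeff f n = 0 := fun n => by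
    have := hf.realFourierCoeff_add n
    constructor
    · intro h0
      rw [h0, mul_zero, eq_comm, mul_eq_zero] at this
      exact this.resolve_left (e2_ne_zero _)
    · intro h0
      rw [h0, mul_zero, mul_eq_zero] at this
      exact this.resolve_left hC
  have hper : ∀ (k r : ℤ), realFourierCoeff f (r + k * m) = 0 ↔ realFourierCoeff f r = 0 := by
    intro k r
    induction k using Int.induction_on with
    | zero => simp
    | succ i ih => rw [← ih, ← hstep (r + i * m)]; ring_nf
    | pred i ih => rw [← ih, ← hstep (r + (-i - 1) * m)]; ring_nf
  have hm' : (0 : ℤ) < m := by exact_mod_cast hm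
  have key := hper (n / m) (n % m)
  rw [Int.emod_add_ediv_mul] at key
  rw [key]
  obtain ⟨i, hi⟩ := Int.eq_ofNat_of_zero_le (Int.emod_nonneg n hm'.ne')
  rw [hi]
  refine h i ?_
  have := Int.emod_lt_of_pos n hm'
  omega

/-- Two theta functions of degree one are proportional. -/
lemma coeff_mul_eq (hf : IsThetaFunction τ 1 C f) (hg : IsThetaFunction τ 1 C g) (hC : C ≠ 0)
    (z : ℂ) : realFourierCoeff f 0 * g z = realFourierCoeff g 0 * f z := by
  have h := (hg.linearComb hf (realFourierCoeff f 0) (-realFourierCoeff g 0)).eq_zero hC one_pos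
    fun i hi => by
      obtain rfl : i = 0 := by omega
      rw [realFourierCoeff_linearComb hg.differentiable.continuous hf.differentiable.continuous]
      push_cast; ring
  have := congrFun h z
  simp only [Pi.zero_apply] at this
  linear_combination this

/-- A degree two theta function vanishing at two points separated by theta functions `u, v`
vanishes identically. -/
lemma eq_zero_of_two (hf : IsThetaFunction τ 2 C f) (hu : IsThetaFunction τ 2 C u)
    (hv : IsThetaFunction τ 2 C v) (hC : C ≠ 0) {p r : ℂ} (fp : f p = 0) (fr : f r = 0)
    (up : u p ≠ 0) (ur : u r = 0) (vp : v p = 0) (vr : v r ≠ 0) : f = 0 := by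
  have hfc := hf.differentiable.continuous
  have huc := hu.differentiable.continuous
  have hvc := hv.differentiable.continuous
  set a := realFourierCoeff
  have huv : ∀ α β : ℂ, (∀ i : ℕ, i < 2 → α * a u i + β * a v i = 0) → α = 0 ∧ β = 0 := by
    intro α β h
    have h0 := (hu.linearComb hv α β).eq_zero hC two_pos fun i hi => by
      rw [realFourierCoeff_linearComb huc hvc]; exact h i hi
    have hp := congrFun h0 p
    have hr := congrFun h0 r
    simp only [vp, ur, Pi.zero_apply, mul_zero, add_zero, zero_add, mul_eq_zero, up, vr,
      or_false] at hp hr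
    exact ⟨hp, hr⟩
  have hdet : a u 0 * a v 1 - a u 1 * a v 0 ≠ 0 := by
    intro hD
    have h1 := huv (a v 0) (-a u 0) fun i hi => by
      interval_cases i
      · push_cast; ring
      · push_cast; linear_combination -hD
    have h2 := huv (a v 1) (-a u 1) fun i hi => by
      interval_cases i
      · push_cast; linear_combination hD
      · push_cast; ring
    have h3 := huv 1 0 fun i hi => by
      interval_cases i
      · simpa using h1.2
      · simpa using h2.2
    exact one_ne_zero h3.1
  have h0 := ((hu.linearComb hv (a v 0 * a f 1 - a v 1 * a f 0)
    (a f 0 * a u 1 - a f 1 * a u 0)).linearComb hf 1 (a u 0 * a v 1 - a u 1 * a v 0)).eq_zero hC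
    two_pos fun i hi => by
      rw [realFourierCoeff_linearComb (by fun_prop) hfc, realFourierCoeff_linearComb huc hvc]
      change 1 * (_ * a u i + _ * a v i) + _ * a f i = 0
      interval_cases i <;> push_cast <;> ring
  have hp := congrFun h0 p
  have hr := congrFun h0 r
  simp only [vp, ur, fp, fr, Pi.zero_apply, mul_zero, add_zero, zero_add, one_mul, mul_eq_zero, up,
    vr, or_false] at hp hr
  ext z
  have hz := congrFun h0 z
  simp only [hp, hr, zero_mul, zero_add, mul_zero, Pi.zero_apply, mul_eq_zero, hdet,
    false_or] at hz
  exact hz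

end IsThetaFunction

/-- The infinite product `∏_{n ≥ 1} (1 - qⁿ x)`. -/
def qProd (q x : ℂ) : ℂ := ∏' n : ℕ, (1 - q ^ (n + 1) * x)

section qProd

variable {q : ℂ}

lemma summable_norm_pow_succ_mul (hq : ‖q‖ < 1) (x : ℂ) :
    Summable fun n : ℕ => ‖q ^ (n + 1) * x‖ := by
  simp_rw [norm_mul, norm_pow]
  exact ((summable_nat_add_iff 1).mpr
    (summable_geometric_of_lt_one (norm_nonneg _) hq)).mul_right _

lemma multipliable_qProd (hq : ‖q‖ < 1) (x : ℂ) :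
    Multipliable fun n : ℕ => 1 - q ^ (n + 1) * x := by
  simp_rw [sub_eq_add_neg]
  exact multipliable_one_add_of_summable (by simpa using summable_norm_pow_succ_mul hq x)

lemma qProd_ne_zero (hq : ‖q‖ < 1) {x : ℂ} (hx : ∀ n : ℕ, q ^ (n + 1) * x ≠ 1) :
    qProd q x ≠ 0 := by
  unfold qProd
  simp_rw [sub_eq_add_neg]
  refine tprod_one_add_ne_zero_of_summable (fun n h => hx n ?_)
    (by simpa using summable_norm_pow_succ_mul hq x)
  linear_combination -h

lemma qProd_ne_zero_of_norm_lt (hq : ‖q‖ < 1) {x : ℂ} (hx : ‖q * x‖ < 1) :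
    qProd q x ≠ 0 := by
  refine qProd_ne_zero hq fun n h => ?_
  have h1 : ‖q ^ (n + 1) * x‖ = 1 := by rw [h, norm_one]
  rw [pow_succ, mul_assoc, norm_mul, norm_pow] at h1
  nlinarith [pow_le_one₀ (n := n) (norm_nonneg q) hq.le, norm_nonneg (q * x)]

lemma qProd_eq_mul (hq : ‖q‖ < 1) (x : ℂ) : qProd q x = (1 - q * x) * qProd q (q * x) := by
  have hshift : ∀ n : ℕ, 1 - q ^ (n + 1 + 1) * x = 1 - q ^ (n + 1) * (q * x) := fun n => by
    rw [pow_succ, mul_assoc]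
  have h : Multipliable fun n : ℕ => 1 - q ^ (n + 1 + 1) * x := by
    simp_rw [hshift]
    exact multipliable_qProd hq (q * x)
  have h0 := tprod_eq_zero_mul' (f := fun n : ℕ => 1 - q ^ (n + 1) * x) h
  simp_rw [hshift] at h0
  rw [qProd, h0, qProd, zero_add, pow_one]

lemma qProd_neg_one_mul (hq : ‖q‖ < 1) : qProd q (-1) * qProd q 1 = qProd (q ^ 2) 1 := by
  rw [qProd, qProd, ← (multipliable_qProd hq _).tprod_mul (multipliable_qProd hq _)]
  exact tprod_congr fun n => by ring

lemma differentiable_qProd (hq : ‖q‖ < 1) : Differentiable ℂ (qProd q) := by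
  have h : HasProdLocallyUniformlyOn (fun (n : ℕ) (x : ℂ) => 1 + -(q ^ (n + 1) * x))
      (fun x => ∏' n : ℕ, (1 + -(q ^ (n + 1) * x))) Set.univ := by
    refine hasProdLocallyUniformlyOn_of_forall_compact isOpen_univ fun K _ hK => ?_
    obtain ⟨R, hR⟩ := hK.isBounded.exists_norm_le
    have hs := ((summable_nat_add_iff 1).mpr
      (summable_geometric_of_lt_one (norm_nonneg _) hq)).mul_right R
    refine hs.hasProdUniformlyOn_nat_one_add hK (.of_forall fun n x hx => ?_)
      fun n => by fun_prop
    rw [norm_neg, norm_mul, norm_pow]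
    exact mul_le_mul_of_nonneg_left (hR x hx) (by positivity)
  have hd := h.differentiableOn (.of_forall fun s => by
    simpa [Finset.prod_fn] using DifferentiableOn.finsetProd (fun _ _ => by fun_prop)) isOpen_univ
  simp_rw [← sub_eq_add_neg] at hd
  exact differentiableOn_univ.mp hd

end qProd

lemma norm_qC_lt_one {τ : ℂ} (hτ : 0 < τ.im) : ‖qC τ‖ < 1 := by
  rw [qC, norm_e2, Real.exp_lt_one_iff]
  have := Real.pi_pos
  simp only [Left.neg_neg_iff]; positivity

section theta

variable {τ : ℂ}

lemma theta_eq_qProd (hτ : 0 < τ.im) (z : ℂ) :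
    theta τ z = e2 (τ / 8) * (e2 (z / 2) - e2 (-(z / 2))) *
      (qProd (qC τ) (e2 z) * qProd (qC τ) (e2 (-z)) * qProd (qC τ) 1) := by
  have hq := norm_qC_lt_one hτ
  rw [theta, qProd, qProd, qProd, ← (multipliable_qProd hq _).tprod_mul (multipliable_qProd hq _),
    ← ((multipliable_qProd hq _).mul (multipliable_qProd hq _)).tprod_mul
      (multipliable_qProd hq _)]
  simp only [zetaC, ← e2_neg, mul_one]
  congr 2
  · rw [e2]; ring_nf
  · rw [e2, e2]; ring_nf

lemma qProd_one_ne_zero (hτ : 0 < τ.im) : qProd (qC τ) 1 ≠ 0 :=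
  qProd_ne_zero_of_norm_lt (norm_qC_lt_one hτ) (by simpa using norm_qC_lt_one hτ)

lemma differentiable_theta (hτ : 0 < τ.im) : Differentiable ℂ (theta τ) := by
  have h : theta τ = fun z => e2 (τ / 8) * (e2 (z / 2) - e2 (-(z / 2))) *
      (qProd (qC τ) (e2 z) * qProd (qC τ) (e2 (-z)) * qProd (qC τ) 1) :=
    funext fun z => theta_eq_qProd hτ z
  have hd := differentiable_qProd (norm_qC_lt_one hτ)
  have h1 : Differentiable ℂ fun z => qProd (qC τ) (e2 z) := hd.comp (by fun_prop)
  have h2 : Differentiable ℂ fun z => qProd (qC τ) (e2 (-z)) := hd.comp (by fun_prop)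
  rw [h]
  fun_prop

lemma e2_half : e2 (1 / 2) = -1 := by
  rw [e2, ← Complex.exp_pi_mul_I]; ring_nf

lemma theta_add_one (hτ : 0 < τ.im) (z : ℂ) : theta τ (z + 1) = -theta τ z := by
  have h : e2 (-((z + 1) / 2)) = -e2 (-(z / 2)) := by
    rw [show -((z + 1) / 2) = -(z / 2) + 1 / 2 - 1 by ring, e2_sub, e2_add, e2_half]; simp
  have h' : e2 ((z + 1) / 2) = -e2 (z / 2) := by rw [add_div, e2_add, e2_half]; ring
  have h'' : e2 (-(z + 1)) = e2 (-z) := by rw [neg_add, ← sub_eq_add_neg, e2_sub]; simp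
  rw [theta_eq_qProd hτ, theta_eq_qProd hτ, h, h', h'', e2_add, e2_one]
  ring_nf

lemma theta_add_period (hτ : 0 < τ.im) (z : ℂ) :
    theta τ (z + τ) = -e2 (-(τ / 2)) * e2 (-z) * theta τ z := by
  have hq := norm_qC_lt_one hτ
  have e1 : e2 (z + τ) = qC τ * e2 z := by rw [e2_add, qC, mul_comm]
  have e3 := qProd_eq_mul hq (e2 z)
  have e4 := qProd_eq_mul hq (e2 (-(z + τ)))
  have e5 : qC τ * e2 (-(z + τ)) = e2 (-z) := by rw [qC, ← e2_add]; ring_nf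
  rw [e5] at e4
  rw [theta_eq_qProd hτ, theta_eq_qProd hτ, e1, e3, e4, add_div, e2_add, neg_add, e2_add, qC]
  have hz : e2 z = e2 (z / 2) ^ 2 := by rw [← e2_nat_mul]; push_cast; ring_nf
  have ht : e2 τ = e2 (τ / 2) ^ 2 := by rw [← e2_nat_mul]; push_cast; ring_nf
  simp only [e2_neg, hz, ht]
  have := e2_ne_zero (z / 2)
  have := e2_ne_zero (τ / 2)
  field_simp
  ring

lemma theta_zero : theta τ 0 = 0 := by simp [theta]

lemma theta_ne_zero (hτ : 0 < τ.im) {z : ℂ} (hz1 : e2 z ≠ 1) (hz : ‖e2 z‖ ≤ 1)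
    (hz' : ‖qC τ‖ < ‖e2 z‖) : theta τ z ≠ 0 := by
  have hq := norm_qC_lt_one hτ
  rw [theta_eq_qProd hτ]
  refine mul_ne_zero (mul_ne_zero (e2_ne_zero _) ?_)
    (mul_ne_zero (mul_ne_zero ?_ ?_) (qProd_one_ne_zero hτ))
  · intro h
    apply hz1
    have : e2 z = e2 (z / 2) * e2 (z / 2) := by rw [← e2_add]; ring_nf
    rw [this]
    nth_rw 1 [sub_eq_zero.mp h]
    rw [← e2_add]; simp
  · refine qProd_ne_zero_of_norm_lt hq ?_
    rw [norm_mul]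
    nlinarith [norm_nonneg (qC τ), norm_nonneg (e2 z)]
  · refine qProd_ne_zero_of_norm_lt hq ?_
    rw [norm_mul, e2_neg, norm_inv, ← div_eq_mul_inv]
    exact (div_lt_one ((norm_nonneg _).trans_lt hz')).mpr hz'

lemma norm_qC_lt_norm_e2 {z : ℂ} (h : z.im < τ.im) : ‖qC τ‖ < ‖e2 z‖ := by
  rw [qC, norm_e2, norm_e2, Real.exp_lt_exp]
  have := Real.pi_pos
  nlinarith

lemma norm_e2_le_one {z : ℂ} (h : 0 ≤ z.im) : ‖e2 z‖ ≤ 1 := by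
  rw [norm_e2, Real.exp_le_one_iff]
  have := Real.pi_pos
  simp only [Left.neg_nonpos_iff]; positivity

lemma theta_half_ne_zero (hτ : 0 < τ.im) : theta τ (1 / 2) ≠ 0 := by
  refine theta_ne_zero hτ ?_ (norm_e2_le_one (by simp)) (norm_qC_lt_norm_e2 (by simpa using hτ))
  rw [e2_half]; norm_num

lemma theta_ne_zero_of_im (hτ : 0 < τ.im) {z : ℂ} (h0 : 0 < z.im) (h1 : z.im < τ.im) :
    theta τ z ≠ 0 := by
  refine theta_ne_zero hτ (fun h => ?_) (norm_e2_le_one h0.le) (norm_qC_lt_norm_e2 h1)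
  have : ‖e2 z‖ < 1 := norm_qC_lt_one h0
  rw [h, norm_one] at this
  exact lt_irrefl _ this

lemma eta_eq_qProd : eta τ = e2 (τ / 24) * qProd (qC τ) 1 := by
  simp only [eta, qProd, mul_one]
  congr 1
  rw [e2]; ring_nf

lemma eta_ne_zero (hτ : 0 < τ.im) : eta τ ≠ 0 := by
  rw [eta_eq_qProd]
  exact mul_ne_zero (e2_ne_zero _) (qProd_one_ne_zero hτ)

lemma phiM21_eq_qProd (hτ : 0 < τ.im) (z : ℂ) :
    phiM21 τ z = (e2 (z / 2) - e2 (-(z / 2))) ^ 2 *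
      (qProd (qC τ) (e2 z) * qProd (qC τ) (e2 (-z))) ^ 2 / qProd (qC τ) 1 ^ 4 := by
  rw [phiM21, theta_eq_qProd hτ, eta_eq_qProd]
  have h := qProd_one_ne_zero hτ
  have h' := e2_ne_zero (τ / 24)
  have : e2 (τ / 8) = e2 (τ / 24) ^ 3 := by rw [← e2_nat_mul]; push_cast; ring_nf
  rw [this]
  field_simp

lemma phiM21_isThetaFunction (hτ : 0 < τ.im) :
    IsThetaFunction τ 2 (e2 (-τ)) (phiM21 τ) where
  differentiable := ((differentiable_theta hτ).pow 2).div_const _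
  add_one z := by rw [phiM21, theta_add_one hτ, phiM21, neg_sq]
  add_period z := by
    rw [phiM21, theta_add_period hτ, phiM21]
    have h1 : e2 (-τ) = e2 (-(τ / 2)) ^ 2 := by rw [← e2_nat_mul]; push_cast; ring_nf
    have h2 : e2 (-((2 : ℕ) * z)) = e2 (-z) ^ 2 := by rw [← e2_nat_mul]; push_cast; ring_nf
    rw [h1, h2]; ring

lemma phiM21_zero : phiM21 τ 0 = 0 := by simp [phiM21, theta_zero]

lemma phiM21_half_ne_zero (hτ : 0 < τ.im) : phiM21 τ (1 / 2) ≠ 0 :=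
  div_ne_zero (pow_ne_zero _ (theta_half_ne_zero hτ)) (pow_ne_zero _ (eta_ne_zero hτ))

/-- The value of `φ_{-2,1}` at the half period `1/2` as an eta quotient. -/
lemma phiM21_half (hτ : 0 < τ.im) :
    phiM21 τ (1 / 2) = -4 * qProd (qC τ ^ 2) 1 ^ 4 / qProd (qC τ) 1 ^ 8 := by
  have h1 : e2 (-(1 / 2)) = -1 := by rw [e2_neg, e2_half]; norm_num
  have h4 : e2 (1 / 2 / 2) = I := by
    rw [e2, show 2 * (Real.pi : ℂ) * I * (1 / 2 / 2) = Real.pi / 2 * I by ring,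
      Complex.exp_pi_div_two_mul_I]
  rw [phiM21_eq_qProd hτ, h1, e2_half, ← qProd_neg_one_mul (norm_qC_lt_one hτ), e2_neg, h4, inv_I]
  have := qProd_one_ne_zero hτ
  field_simp
  linear_combination 4 * qProd (qC τ) (-1) ^ 4 * I_sq

/-- `φ_{-2,1}` vanishes to second order at the origin with leading coefficient `(2πi)²`. -/
lemma tendsto_phiM21_div_sq (hτ : 0 < τ.im) :
    Filter.Tendsto (fun z => phiM21 τ z / z ^ 2) (nhdsWithin 0 {0}ᶜ)
      (nhds ((2 * Real.pi * I) ^ 2)) := by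
  have hd : HasDerivAt (fun z : ℂ => e2 (z / 2) - e2 (-(z / 2))) (2 * Real.pi * I) 0 := by
    have h0 : HasDerivAt e2 (2 * Real.pi * I) 0 :=
      ((hasDerivAt_id' (0 : ℂ)).const_mul (2 * (Real.pi : ℂ) * I)).cexp.congr_deriv (by simp)
    have h1 : HasDerivAt (fun z : ℂ => e2 (z / 2)) (2 * Real.pi * I * (1 / 2)) 0 :=
      HasDerivAt.comp (h₂ := e2) 0 (by simpa using h0) ((hasDerivAt_id' (0 : ℂ)).div_const 2)
    have h2 : HasDerivAt (fun z : ℂ => e2 (-(z / 2))) (2 * Real.pi * I * -(1 / 2)) 0 :=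
      HasDerivAt.comp (h₂ := e2) 0 (by simpa using h0) ((hasDerivAt_id' (0 : ℂ)).div_const 2).fun_neg
    exact (h1.fun_sub h2).congr_deriv (by ring)
  have hs := hd.tendsto_slope
  have hc : Filter.Tendsto (fun z => (qProd (qC τ) (e2 z) * qProd (qC τ) (e2 (-z))) ^ 2 /
      qProd (qC τ) 1 ^ 4) (nhdsWithin 0 {0}ᶜ) (nhds 1) := by
    have hq := (differentiable_qProd (norm_qC_lt_one hτ)).continuous
    have h1 : Continuous fun z => qProd (qC τ) (e2 z) := hq.comp (by fun_prop)
    have h2 : Continuous fun z => qProd (qC τ) (e2 (-z)) := hq.comp (by fun_prop)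
    have h3 : Continuous fun z => (qProd (qC τ) (e2 z) * qProd (qC τ) (e2 (-z))) ^ 2 /
      qProd (qC τ) 1 ^ 4 := ((h1.mul h2).pow 2).div_const _
    refine (h3.tendsto' 0 1 ?_).mono_left nhdsWithin_le_nhds
    have := qProd_one_ne_zero hτ
    rw [neg_zero, e2_zero]
    field_simp
  have := (hs.pow 2).mul hc
  rw [mul_one] at this
  refine this.congr' (Filter.Eventually.of_forall fun z => ?_)
  simp only [slope_def_field, phiM21_eq_qProd hτ, zero_div, neg_zero, sub_self, sub_zero]
  ring

end theta

lemma neg_one_div_im_pos {τ : ℂ} (hτ : 0 < τ.im) : 0 < (-1 / τ).im := by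
  have := UpperHalfPlane.im_pos (ModularGroup.S • (⟨τ, hτ⟩ : UpperHalfPlane))
  rw [UpperHalfPlane.modular_S_smul] at this
  simpa [neg_div] using this

lemma ne_zero_of_im_pos {τ : ℂ} (hτ : 0 < τ.im) : τ ≠ 0 := by
  rintro rfl; simp at hτ

/-- Pulling a theta function of degree two back along `τ ↦ -1/τ`. -/
lemma IsThetaFunction.comp_inversion {τ : ℂ} (hτ : τ ≠ 0) {f : ℂ → ℂ}
    (hf : IsThetaFunction (-1 / τ) 2 (e2 (-(-1 / τ))) f) :
    IsThetaFunction τ 2 (e2 (-τ)) (fun z => e2 (-(z ^ 2 / τ)) * f (z / τ)) where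
  differentiable := by
    have := hf.differentiable.comp (f := fun z : ℂ => z / τ) (by fun_prop)
    exact Differentiable.mul (by fun_prop) this
  add_one z := by
    have h := hf.add_period ((z + 1) / τ)
    rw [show (z + 1) / τ + -1 / τ = z / τ by ring] at h
    rw [h, ← mul_assoc, ← mul_assoc, ← e2_add, ← e2_add]
    congr 2
    push_cast; field_simp; ring
  add_period z := by
    rw [add_div, div_self hτ, hf.add_one, ← mul_assoc, ← e2_add, ← e2_add]
    congr 2
    push_cast; field_simp; ring

/-- The transformation of `φ_{-2,1}` under `τ ↦ -1/τ`. -/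
lemma phiM21_inversion {τ : ℂ} (hτ : 0 < τ.im) {u : ℂ → ℂ}
    (hu : IsThetaFunction τ 2 (e2 (-τ)) u) (u0 : u 0 ≠ 0) (u1 : u (1 / 2) = 0) (z : ℂ) :
    e2 (-(z ^ 2 / τ)) * phiM21 (-1 / τ) (z / τ) = (τ ^ 2)⁻¹ * phiM21 τ z := by
  have h0 := ne_zero_of_im_pos hτ
  have hg := (phiM21_isThetaFunction (neg_one_div_im_pos hτ)).comp_inversion h0
  have hφ := phiM21_isThetaFunction hτ
  set g : ℂ → ℂ := fun z => e2 (-(z ^ 2 / τ)) * phiM21 (-1 / τ) (z / τ) with hgdef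
  have hhalf := phiM21_half_ne_zero hτ
  have hlin := (hg.linearComb hφ (phiM21 τ (1 / 2)) (-g (1 / 2))).eq_zero_of_two hu hφ
    (e2_ne_zero _) (p := 0) (r := 1 / 2) (by simp [hgdef, phiM21_zero]) (by ring) u0 u1
    phiM21_zero hhalf
  have hprop : ∀ z, g z = g (1 / 2) / phiM21 τ (1 / 2) * phiM21 τ z := fun z => by
    have := congrFun hlin z
    simp only [Pi.zero_apply] at this
    field_simp
    linear_combination this
  set κ := g (1 / 2) / phiM21 τ (1 / 2)
  have hlim1 : Filter.Tendsto (fun z => g z / z ^ 2) (nhdsWithin 0 {0}ᶜ)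
      (nhds (κ * (2 * Real.pi * I) ^ 2)) := by
    simp_rw [hprop, mul_div_assoc]
    exact (tendsto_phiM21_div_sq hτ).const_mul κ
  have hlim2 : Filter.Tendsto (fun z => g z / z ^ 2) (nhdsWithin 0 {0}ᶜ)
      (nhds (1 * (2 * Real.pi * I) ^ 2 * (τ ^ 2)⁻¹)) := by
    have hw : Filter.Tendsto (fun z : ℂ => z / τ) (nhdsWithin 0 {0}ᶜ) (nhdsWithin 0 {0}ᶜ) := by
      refine tendsto_nhdsWithin_iff.mpr ⟨?_, ?_⟩
      · exact ((by fun_prop : Continuous fun z : ℂ => z / τ).tendsto' 0 0 (by simp)).mono_left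
          nhdsWithin_le_nhds
      · filter_upwards [self_mem_nhdsWithin] with z hz
        exact div_ne_zero hz h0
    have he : Filter.Tendsto (fun z => e2 (-(z ^ 2 / τ))) (nhdsWithin 0 {0}ᶜ) (nhds 1) :=
      ((by fun_prop : Continuous fun z => e2 (-(z ^ 2 / τ))).tendsto' 0 1 (by simp)).mono_left
        nhdsWithin_le_nhds
    refine ((he.mul ((tendsto_phiM21_div_sq (neg_one_div_im_pos hτ)).comp hw)).mul_const
      (τ ^ 2)⁻¹).congr' ?_
    filter_upwards [self_mem_nhdsWithin] with z hz
    have hz : z ≠ 0 := hz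
    simp only [Function.comp, hgdef]
    field_simp
  have huniq := tendsto_nhds_unique hlim1 hlim2
  have hκ : κ = (τ ^ 2)⁻¹ := by
    refine mul_right_cancel₀ (b := (2 * (Real.pi : ℂ) * I) ^ 2) ?_ (by linear_combination huniq)
    simp [Real.pi_ne_zero]
  rw [← hκ]
  exact hprop z

section jacobiTheta₂

variable {τ : ℂ}

lemma theta00_eq (τ z : ℂ) : theta00 τ z = jacobiTheta₂ z τ :=
  tsum_congr fun n => by rw [jacobiTheta₂_term, add_comm]

lemma theta01_eq (τ z : ℂ) : theta01 τ z = jacobiTheta₂ (z + 1 / 2) τ :=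
  tsum_congr fun n => by
    rw [jacobiTheta₂_term, ← Complex.exp_pi_mul_I, ← Complex.exp_int_mul, ← Complex.exp_add]
    ring_nf

lemma theta10_eq (τ z : ℂ) :
    theta10 τ z = e2 (τ / 8 + z / 2) * jacobiTheta₂ (z + τ / 2) τ := by
  rw [theta10, jacobiTheta₂, ← Complex.exp_add, e2]
  congr 1
  · ring_nf
  · exact tsum_congr fun n => by rw [jacobiTheta₂_term]; ring_nf

lemma jacobiTheta₂_isThetaFunction (hτ : 0 < τ.im) :
    IsThetaFunction τ 1 (e2 (-(τ / 2))) (jacobiTheta₂ · τ) where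
  differentiable z := differentiableAt_jacobiTheta₂_fst z hτ
  add_one z := jacobiTheta₂_add_left z τ
  add_period z := by
    rw [jacobiTheta₂_add_left', ← e2_add, e2]
    push_cast; ring_nf

lemma thetaShift_isThetaFunction (hτ : 0 < τ.im) :
    IsThetaFunction τ 1 (e2 (-(τ / 2))) (fun z => e2 (z / 2) * theta τ (z + 1 / 2 + τ / 2)) where
  differentiable :=
    Differentiable.mul (by fun_prop) ((differentiable_theta hτ).comp
      (f := fun z => z + 1 / 2 + τ / 2) (by fun_prop))
  add_one z := by
    rw [show z + 1 + 1 / 2 + τ / 2 = z + 1 / 2 + τ / 2 + 1 by ring, theta_add_one hτ, add_div,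
      e2_add, e2_half]
    ring
  add_period z := by
    rw [show z + τ + 1 / 2 + τ / 2 = z + 1 / 2 + τ / 2 + τ by ring, theta_add_period hτ, add_div,
      e2_add, neg_add, neg_add, e2_add, e2_add, e2_neg (1 / 2), e2_half]
    have h2 : e2 (τ / 2) * e2 (-(τ / 2)) = 1 := by rw [← e2_add]; simp
    push_cast
    rw [one_mul]
    linear_combination e2 (z / 2) * e2 (-(τ / 2)) * e2 (-z) * theta τ (z + 1 / 2 + τ / 2) * h2

lemma norm_jacobiTheta₂_term_ofReal (n : ℤ) (x : ℝ) (τ : ℂ) :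
    ‖jacobiTheta₂_term n x τ‖ = Real.exp (-Real.pi * n ^ 2 * τ.im) := by
  rw [norm_jacobiTheta₂_term]; simp

lemma summable_exp_neg_sq {t : ℝ} (ht : 0 < t) :
    Summable fun n : ℤ => Real.exp (-Real.pi * n ^ 2 * t) := by
  have := ((summable_jacobiTheta₂_term_iff (0 : ℝ) (t * I)).mpr (by simpa using ht)).norm
  simpa [norm_jacobiTheta₂_term_ofReal, -ofReal_zero] using this

lemma realFourierCoeff_jacobiTheta₂ (hτ : 0 < τ.im) :
    realFourierCoeff (jacobiTheta₂ · τ) 0 = 1 := by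
  have h := intervalIntegral.hasSum_integral_of_dominated_convergence
    (F := fun (n : ℤ) (x : ℝ) => jacobiTheta₂_term n x τ) (f := fun x : ℝ => jacobiTheta₂ x τ)
    (a := 0) (b := 1) (μ := MeasureTheory.volume)
    (fun n _ => Real.exp (-Real.pi * n ^ 2 * τ.im))
    (fun n => Continuous.aestronglyMeasurable (by unfold jacobiTheta₂_term; fun_prop))
    (fun n => .of_forall fun x _ => (norm_jacobiTheta₂_term_ofReal n x τ).le)
    (.of_forall fun x _ => summable_exp_neg_sq hτ) (by simp)
    (.of_forall fun x _ => hasSum_jacobiTheta₂_term x hτ)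
  have hterm : ∀ n : ℤ, ∫ x in (0 : ℝ)..1, jacobiTheta₂_term n x τ = if n = 0 then 1 else 0 := by
    intro n
    split_ifs with hn
    · simp [hn, jacobiTheta₂_term]
    · have hc : 2 * (Real.pi : ℂ) * I * n ≠ 0 := by simp [Real.pi_ne_zero, hn]
      simp only [jacobiTheta₂_term, Complex.exp_add]
      rw [intervalIntegral.integral_mul_const, integral_exp_mul_complex hc]
      have := e2_int n
      rw [e2] at this
      simp [this]
  simp_rw [hterm] at h
  have h1 := h.unique (hasSum_ite_eq 0 1)
  simpa [realFourierCoeff] using h1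

lemma thetaShift_eq (hτ : 0 < τ.im) (z : ℂ) : e2 (z / 2) * theta τ (z + 1 / 2 + τ / 2) =
    realFourierCoeff (fun z => e2 (z / 2) * theta τ (z + 1 / 2 + τ / 2)) 0 * jacobiTheta₂ z τ := by
  have := (jacobiTheta₂_isThetaFunction hτ).coeff_mul_eq (thetaShift_isThetaFunction hτ)
    (e2_ne_zero _) z
  rwa [realFourierCoeff_jacobiTheta₂ hτ, one_mul] at this

lemma jacobiTheta₂_ne_zero (hτ : 0 < τ.im) {z : ℂ} (hz : theta τ (z + 1 / 2 + τ / 2) ≠ 0) :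
    jacobiTheta₂ z τ ≠ 0 :=
  right_ne_zero_of_mul (thetaShift_eq hτ z ▸ mul_ne_zero (e2_ne_zero _) hz)

lemma jacobiTheta₂_zero_ne_zero (hτ : 0 < τ.im) : jacobiTheta₂ 0 τ ≠ 0 :=
  jacobiTheta₂_ne_zero hτ (theta_ne_zero_of_im hτ (by simpa using hτ) (by simpa using hτ))

lemma jacobiTheta₂_half_ne_zero (hτ : 0 < τ.im) : jacobiTheta₂ (1 / 2) τ ≠ 0 := by
  rw [← jacobiTheta₂_neg_left]
  exact jacobiTheta₂_ne_zero hτ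
    (theta_ne_zero_of_im hτ (by simpa using hτ) (by simpa using hτ))

lemma jacobiTheta₂_half_period_ne_zero (hτ : 0 < τ.im) : jacobiTheta₂ (τ / 2) τ ≠ 0 := by
  rw [← jacobiTheta₂_neg_left]
  refine jacobiTheta₂_ne_zero hτ ?_
  rw [neg_add_eq_sub, sub_add_cancel]
  exact theta_half_ne_zero hτ

lemma jacobiTheta₂_eq_zero (hτ : 0 < τ.im) : jacobiTheta₂ (1 / 2 + τ / 2) τ = 0 := by
  have h := thetaShift_eq hτ (-(1 / 2) - τ / 2)
  have h0 := thetaShift_eq hτ 0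
  have hne : e2 (0 / 2) * theta τ (0 + 1 / 2 + τ / 2) ≠ 0 :=
    mul_ne_zero (e2_ne_zero _) (theta_ne_zero_of_im hτ (by simpa using hτ) (by simpa using hτ))
  rw [h0] at hne
  rw [show -(1 / 2) - τ / 2 + 1 / 2 + τ / 2 = 0 by ring, theta_zero, mul_zero, eq_comm,
    mul_eq_zero, or_iff_right (left_ne_zero_of_mul hne)] at h
  rw [← jacobiTheta₂_neg_left, ← h]
  ring_nf

end jacobiTheta₂

section phi01

variable {τ : ℂ}

lemma isThetaFunction_div_sq {f : ℂ → ℂ} (hf : Differentiable ℂ f) {ε δ : ℂ} (hε : ε ^ 2 = 1)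
    (hδ : δ ^ 2 = 1) (h1 : ∀ z, f (z + 1) = ε * f z)
    (hτ : ∀ z, f (z + τ) = δ * (e2 (-(τ / 2)) * e2 (-z)) * f z) (a : ℂ) :
    IsThetaFunction τ 2 (e2 (-τ)) (fun z => (f z / a) ^ 2) where
  differentiable := (hf.div_const _).pow 2
  add_one z := by rw [h1, mul_div_assoc, mul_pow, hε, one_mul]
  add_period z := by
    have h2 : e2 (-τ) = e2 (-(τ / 2)) ^ 2 := by rw [← e2_nat_mul]; push_cast; ring_nf
    have h3 : e2 (-((2 : ℕ) * z)) = e2 (-z) ^ 2 := by rw [← e2_nat_mul]; push_cast; ring_nf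
    rw [hτ, h2, h3, mul_div_assoc, mul_pow, mul_pow, hδ]
    ring

lemma theta00_add_period (τ z : ℂ) :
    jacobiTheta₂ (z + τ) τ = e2 (-(τ / 2)) * e2 (-z) * jacobiTheta₂ z τ := by
  rw [jacobiTheta₂_add_left', ← e2_add, e2]
  ring_nf

lemma xi00_sq_isThetaFunction (hτ : 0 < τ.im) :
    IsThetaFunction τ 2 (e2 (-τ)) (fun z => xi00 τ z ^ 2) := by
  have h : theta00 τ = (jacobiTheta₂ · τ) := funext (theta00_eq τ)
  refine isThetaFunction_div_sq (ε := 1) (δ := 1) ?_ (by norm_num) (by norm_num) ?_ ?_ _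
  · exact h ▸ (jacobiTheta₂_isThetaFunction hτ).differentiable
  · intro z
    rw [theta00_eq, theta00_eq, jacobiTheta₂_add_left, one_mul]
  · intro z
    rw [theta00_eq, theta00_eq, theta00_add_period, one_mul]

lemma xi01_sq_isThetaFunction (hτ : 0 < τ.im) :
    IsThetaFunction τ 2 (e2 (-τ)) (fun z => xi01 τ z ^ 2) := by
  have h : theta01 τ = fun z => jacobiTheta₂ (z + 1 / 2) τ := funext (theta01_eq τ)
  refine isThetaFunction_div_sq (ε := 1) (δ := -1) ?_ (by norm_num) (by norm_num) ?_ ?_ _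
  · exact h ▸ (jacobiTheta₂_isThetaFunction hτ).differentiable.comp
      (f := fun z => z + 1 / 2) (by fun_prop)
  · intro z
    rw [theta01_eq, theta01_eq, add_right_comm, jacobiTheta₂_add_left, one_mul]
  · intro z
    rw [theta01_eq, theta01_eq, add_right_comm, theta00_add_period, neg_add, e2_add _ (-(1 / 2)),
      e2_neg (1 / 2), e2_half]
    ring

lemma xi10_sq_isThetaFunction (hτ : 0 < τ.im) :
    IsThetaFunction τ 2 (e2 (-τ)) (fun z => xi10 τ z ^ 2) := by
  have h : theta10 τ = fun z => e2 (τ / 8 + z / 2) * jacobiTheta₂ (z + τ / 2) τ :=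
    funext (theta10_eq τ)
  refine isThetaFunction_div_sq (ε := -1) (δ := 1) ?_ (by norm_num) (by norm_num) ?_ ?_ _
  · rw [h]
    exact Differentiable.mul (by fun_prop) ((jacobiTheta₂_isThetaFunction hτ).differentiable.comp
      (f := fun z => z + τ / 2) (by fun_prop))
  · intro z
    rw [theta10_eq, theta10_eq, add_right_comm, jacobiTheta₂_add_left, add_div z, ← add_assoc,
      e2_add _ (1 / 2), e2_half]
    ring
  · intro z
    rw [theta10_eq, theta10_eq, add_right_comm, theta00_add_period, add_div z, ← add_assoc,
      e2_add _ (τ / 2), neg_add, e2_add _ (-(τ / 2)), e2_neg (τ / 2)]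
    have := e2_ne_zero (τ / 2)
    field_simp

lemma xi00_zero (hτ : 0 < τ.im) : xi00 τ 0 = 1 :=
  div_self (by rw [theta00_eq]; exact jacobiTheta₂_zero_ne_zero hτ)

lemma xi01_zero (hτ : 0 < τ.im) : xi01 τ 0 = 1 :=
  div_self (by rw [theta01_eq, zero_add]; exact jacobiTheta₂_half_ne_zero hτ)

lemma xi10_zero (hτ : 0 < τ.im) : xi10 τ 0 = 1 :=
  div_self (by
    rw [theta10_eq, zero_add]
    exact mul_ne_zero (e2_ne_zero _) (jacobiTheta₂_half_period_ne_zero hτ))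

lemma xi10_half (hτ : 0 < τ.im) : xi10 τ (1 / 2) = 0 := by
  rw [xi10, theta10_eq, jacobiTheta₂_eq_zero hτ, mul_zero, zero_div]

lemma phi01_isThetaFunction (hτ : 0 < τ.im) : IsThetaFunction τ 2 (e2 (-τ)) (phi01 τ) := by
  have h := ((xi00_sq_isThetaFunction hτ).linearComb (xi01_sq_isThetaFunction hτ) 4 4).linearComb
    (xi10_sq_isThetaFunction hτ) 1 4
  have he : phi01 τ = fun z => 1 * (4 * xi00 τ z ^ 2 + 4 * xi01 τ z ^ 2) + 4 * xi10 τ z ^ 2 := by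
    ext z; rw [phi01]; ring
  rwa [he]

lemma phi01_zero (hτ : 0 < τ.im) : phi01 τ 0 = 12 := by
  rw [phi01, xi00_zero hτ, xi01_zero hτ, xi10_zero hτ]; norm_num

lemma phi01_half (hτ : 0 < τ.im) : phi01 τ (1 / 2) =
    4 * ((jacobiTheta₂ (1 / 2 : ℝ) τ / jacobiTheta₂ (0 : ℝ) τ) ^ 2 +
      (jacobiTheta₂ (0 : ℝ) τ / jacobiTheta₂ (1 / 2 : ℝ) τ) ^ 2) := by
  have h : jacobiTheta₂ (1 / 2 + 1 / 2) τ = jacobiTheta₂ 0 τ := by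
    rw [← jacobiTheta₂_add_left 0]; norm_num
  rw [phi01, xi10_half hτ, xi00, xi01, theta00_eq, theta00_eq, theta01_eq, theta01_eq, h]
  norm_num

lemma jacobiTheta₂_add_one_right (z τ : ℂ) :
    jacobiTheta₂ z (τ + 1) = jacobiTheta₂ (z + 1 / 2) τ :=
  tsum_congr fun n => by
    rw [jacobiTheta₂_term, jacobiTheta₂_term]
    obtain ⟨k, hk⟩ := (Int.even_mul_succ_self (n - 1)).two_dvd
    have h2 : (n : ℂ) ^ 2 = n + 2 * k := by
      have : n ^ 2 = n + 2 * k := by linear_combination hk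
      exact_mod_cast this
    rw [show 2 * Real.pi * I * n * z + Real.pi * I * n ^ 2 * (τ + 1) =
      2 * Real.pi * I * n * (z + 1 / 2) + Real.pi * I * n ^ 2 * τ + k * (2 * Real.pi * I) by
        linear_combination Real.pi * I * h2]
    exact Complex.exp_periodic.int_mul k _

lemma phi01_add_one (τ z : ℂ) : phi01 (τ + 1) z = phi01 τ z := by
  have h0 : ∀ z, theta00 (τ + 1) z = theta01 τ z := fun z => by
    rw [theta00_eq, theta01_eq, jacobiTheta₂_add_one_right]
  have h1 : ∀ z, theta01 (τ + 1) z = theta00 τ z := fun z => by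
    rw [theta00_eq, theta01_eq, jacobiTheta₂_add_one_right, ← jacobiTheta₂_add_left z]
    ring_nf
  have h2 : ∀ z, theta10 (τ + 1) z = e2 (1 / 8) * theta10 τ z := fun z => by
    rw [theta10_eq, theta10_eq, jacobiTheta₂_add_one_right, ← mul_assoc, ← e2_add,
      ← jacobiTheta₂_add_left (z + τ / 2)]
    ring_nf
  rw [phi01, phi01, xi00, xi01, xi10, xi00, xi01, xi10, h0, h0, h1, h1, h2, h2,
    mul_div_mul_left _ _ (e2_ne_zero _)]
  ring

lemma phi01_inversion (hτ : 0 < τ.im) (z : ℂ) :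
    phi01 (-1 / τ) (z / τ) = e2 (z ^ 2 / τ) * phi01 τ z := by
  have hne := ne_zero_of_im_pos hτ
  set A : ℂ := (-I * τ) ^ (1 / 2 : ℂ)
  have hA : A ≠ 0 := by simp [A, Complex.cpow_eq_zero_iff, hne]
  have key : ∀ w, jacobiTheta₂ (w / τ) (-1 / τ) = A * e2 (w ^ 2 / (2 * τ)) * jacobiTheta₂ w τ :=
    fun w => by
      have h : cexp (-Real.pi * I * w ^ 2 / τ) = (e2 (w ^ 2 / (2 * τ)))⁻¹ := by
        rw [← e2_neg, e2]; congr 1; field_simp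
      have := e2_ne_zero (w ^ 2 / (2 * τ))
      rw [jacobiTheta₂_functional_equation w, h, show (-I * τ) ^ (1 / 2 : ℂ) = A from rfl]
      generalize e2 (w ^ 2 / (2 * τ)) = E at this ⊢
      field_simp
  have h0 : ∀ w, theta00 (-1 / τ) (w / τ) = A * e2 (w ^ 2 / (2 * τ)) * theta00 τ w := fun w => by
    rw [theta00_eq, theta00_eq, key]
  have h1 : ∀ w, theta01 (-1 / τ) (w / τ) = A * e2 (w ^ 2 / (2 * τ)) * theta10 τ w := fun w => by
    rw [theta01_eq, theta10_eq, show w / τ + 1 / 2 = (w + τ / 2) / τ by field_simp, key,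
      mul_assoc A, mul_assoc A, ← mul_assoc (e2 _) (e2 _), ← e2_add]
    congr 3
    field_simp; ring
  have h2 : ∀ w, theta10 (-1 / τ) (w / τ) = A * e2 (w ^ 2 / (2 * τ)) * theta01 τ w := fun w => by
    rw [theta01_eq, theta10_eq, show w / τ + -1 / τ / 2 = (w - 1 / 2) / τ by field_simp; ring, key,
      ← jacobiTheta₂_add_left (w - 1 / 2), show w - 1 / 2 + 1 = w + 1 / 2 by ring,
      ← mul_assoc, mul_left_comm, ← e2_add]
    congr 3
    field_simp; ring
  have hx : ∀ a b : ℂ, (A * e2 (z ^ 2 / (2 * τ)) * a / (A * b)) ^ 2 =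
      e2 (z ^ 2 / τ) * (a / b) ^ 2 := fun a b => by
    rw [mul_assoc, mul_div_mul_left _ _ hA, mul_div_assoc, mul_pow, ← e2_nat_mul]
    congr 2
    push_cast; field_simp
  have h0' := h0 0
  have h1' := h1 0
  have h2' := h2 0
  simp only [zero_div, ne_eq, OfNat.ofNat_ne_zero, not_false_eq_true, zero_pow, e2_zero,
    mul_one] at h0' h1' h2'
  rw [phi01, phi01, xi00, xi01, xi10, xi00, xi01, xi10, h0, h1, h2, h0', h1', h2', hx, hx, hx]
  ring

lemma phiM21_add_one (hτ : 0 < τ.im) (z : ℂ) : phiM21 (τ + 1) z = phiM21 τ z := by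
  have h : qC (τ + 1) = qC τ := by rw [qC, e2_add, e2_one, mul_one, qC]
  rw [phiM21_eq_qProd hτ, phiM21_eq_qProd (by simpa using hτ), h]

end phi01

section cusp

open Filter Topology

lemma differentiableOn_jacobiTheta₂ (x : ℂ) :
    DifferentiableOn ℂ (jacobiTheta₂ x) {τ | 0 < τ.im} := fun _ hτ =>
  (differentiableAt_jacobiTheta₂_snd x hτ).differentiableWithinAt

lemma differentiableOn_phi01_half :
    DifferentiableOn ℂ (fun τ => phi01 τ (1 / 2)) {τ | 0 < τ.im} := by
  have h0 := differentiableOn_jacobiTheta₂ (0 : ℝ)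
  have h1 := differentiableOn_jacobiTheta₂ (1 / 2 : ℝ)
  refine DifferentiableOn.congr (((h1.div h0 fun τ hτ => ?_).pow 2 |>.add
    ((h0.div h1 fun τ hτ => ?_).pow 2)).const_mul 4) fun τ hτ => phi01_half hτ
  · simpa using jacobiTheta₂_zero_ne_zero hτ
  · simpa using jacobiTheta₂_half_ne_zero hτ

lemma eventually_im_ge (y : ℝ) : ∀ᶠ τ in comap im atTop, y ≤ τ.im :=
  tendsto_comap.eventually (eventually_ge_atTop y)

lemma tendsto_jacobiTheta₂ (x : ℝ) :
    Tendsto (jacobiTheta₂ x) (comap im atTop) (𝓝 1) := by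
  have h := tendsto_tsum_of_dominated_convergence (𝓕 := comap im atTop)
    (f := fun τ (n : ℤ) => jacobiTheta₂_term n x τ) (g := fun n : ℤ => if n = 0 then 1 else 0)
    (summable_exp_neg_sq one_pos) (fun n => ?_) ?_
  · rwa [tsum_ite_eq] at h
  · split_ifs with hn
    · simpa [hn, jacobiTheta₂_term] using tendsto_const_nhds
    · rw [tendsto_zero_iff_norm_tendsto_zero]
      simp_rw [norm_jacobiTheta₂_term_ofReal, neg_mul]
      refine Real.tendsto_exp_neg_atTop_nhds_zero.comp (tendsto_comap.const_mul_atTop ?_)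
      have := Real.pi_pos
      positivity
  · filter_upwards [eventually_im_ge 1] with τ hτ n
    rw [norm_jacobiTheta₂_term_ofReal, Real.exp_le_exp]
    have := Real.pi_pos
    nlinarith [mul_nonneg this.le (sq_nonneg (n : ℝ))]

lemma tendsto_phi01_half : Tendsto (fun τ => phi01 τ (1 / 2)) (comap im atTop) (𝓝 8) := by
  have h0 := tendsto_jacobiTheta₂ 0
  have h1 := tendsto_jacobiTheta₂ (1 / 2)
  have h := (((h1.div h0 one_ne_zero).pow 2).add ((h0.div h1 one_ne_zero).pow 2)).const_mul 4
  norm_num only at h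
  refine h.congr' ?_
  filter_upwards [eventually_im_ge 1] with τ hτ
  rw [phi01_half (zero_lt_one.trans_le hτ)]
  norm_num

lemma tendsto_qC : Tendsto qC (comap im atTop) (𝓝 0) := by
  rw [tendsto_zero_iff_norm_tendsto_zero]
  simp_rw [qC, norm_e2]
  exact Real.tendsto_exp_neg_atTop_nhds_zero.comp (tendsto_comap.const_mul_atTop (by
    have := Real.pi_pos
    positivity))

lemma differentiableOn_qProd_one :
    DifferentiableOn ℂ (fun q => qProd q 1) (Metric.ball 0 1) := by
  simpa [qProd] using ModularForm.differentiableOn_tprod_one_sub_pow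

lemma differentiableOn_phiM21_half :
    DifferentiableOn ℂ (fun τ => phiM21 τ (1 / 2)) {τ | 0 < τ.im} := by
  have hq : DifferentiableOn ℂ qC {τ | 0 < τ.im} := differentiable_e2.differentiableOn
  have h1 := differentiableOn_qProd_one.comp hq fun τ hτ => by simpa using norm_qC_lt_one hτ
  have h2 := differentiableOn_qProd_one.comp (hq.pow 2) fun τ hτ => by
    simpa using pow_lt_one₀ (norm_nonneg _) (norm_qC_lt_one hτ) two_ne_zero
  exact ((((h2.pow 4).const_mul (-4)).div (h1.pow 8)) fun τ hτ =>
    pow_ne_zero _ (qProd_one_ne_zero hτ)).congr fun τ hτ => phiM21_half hτ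

lemma tendsto_phiM21_half : Tendsto (fun τ => phiM21 τ (1 / 2)) (comap im atTop) (𝓝 (-4)) := by
  have hc : Tendsto (fun q => qProd q 1) (𝓝 0) (𝓝 1) := by
    have := (differentiableOn_qProd_one.differentiableAt
      (Metric.ball_mem_nhds 0 one_pos)).continuousAt.tendsto
    simpa [qProd] using this
  have h1 := hc.comp tendsto_qC
  have h2 := hc.comp (f := fun τ => qC τ ^ 2) (x := comap im atTop)
    (by simpa using tendsto_qC.pow 2)
  have h := ((h2.pow 4).const_mul (-4)).div (h1.pow 8) (by norm_num)
  norm_num only at h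
  refine h.congr' ?_
  filter_upwards [eventually_im_ge 1] with τ hτ
  exact (phiM21_half (zero_lt_one.trans_le hτ)).symm

end cusp

section levelOne

open Filter Topology UpperHalfPlane ModularForm MatrixGroups CongruenceSubgroup Manifold
open scoped ModularForm

/-- A holomorphic function on the upper half-plane of weight `k < 12` for `SL₂(ℤ)` which
vanishes at infinity is zero. -/
lemma eq_zero_of_isZeroAtImInfty {k : ℤ} (hk : k < 12) {F : ℍ → ℂ} (hF : MDiff F)
    (hS : F ∣[k] ModularGroup.S = F) (hT : F ∣[k] ModularGroup.T = F)
    (h0 : IsZeroAtImInfty F) : F = 0 := by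
  have hSL := SlashInvariantForm.slash_action_generators_SL2Z hS hT
  let G : CuspForm 𝒮ℒ k :=
    { toFun := F
      slash_action_eq' := by
        rintro _ ⟨γ, rfl⟩
        exact hSL γ
      holo' := hF
      zero_at_cusps' := fun hc => by
        rw [OnePoint.isZeroAt_iff_forall_SL2Z hc]
        intro γ _
        rwa [hSL γ] }
  have := rank_zero_iff_forall_zero.mp (CuspForm.rank_eq_zero_of_weight_lt_twelve hk) G
  ext τ
  exact DFunLike.congr_fun this τ

lemma E_eq_Eis {k : ℕ} (hk : 3 ≤ k) (hk2 : Even k) (τ : ℍ) : E hk τ = Eis k τ := by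
  rw [EisensteinSeries.q_expansion_bernoulli hk hk2, Eis]
  congr 2
  simp_rw [zpow_natCast]
  rw [tsum_pnat_eq_tsum_succ
    (f := fun n => (ArithmeticFunction.sigma (k - 1) n : ℂ) * cexp (2 * Real.pi * Complex.I * τ) ^ n)]
  exact tsum_congr fun n => by rw [ArithmeticFunction.sigma_apply]; rfl

lemma tendsto_E {k : ℕ} (hk : 3 ≤ k) (hk2 : Even k) :
    Tendsto (E hk) atImInfty (𝓝 1) := by
  have hanal := ModularFormClass.analyticAt_cuspFunction_zero (E hk) one_pos
    one_mem_strictPeriods_SL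
  have hper := SlashInvariantFormClass.periodic_comp_ofComplex (E hk) one_mem_strictPeriods_SL
  have h0 : cuspFunction 1 (E hk) 0 = 1 := by
    rw [cuspFunction_apply_zero one_pos hanal hper, ← qExpansion_coeff_zero one_pos hanal hper,
      EisensteinSeries.E_qExpansion_coeff_zero hk hk2]
  rw [← h0]
  exact (hanal.continuousAt.tendsto.comp (qParam_tendsto_atImInfty one_pos)).congr
    fun τ => SlashInvariantFormClass.eq_cuspFunction (E hk) τ one_mem_strictPeriods_SL one_ne_zero

/-- A holomorphic function of level one and weight `k < 12` is the multiple of the Eisenstein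
series with the same value at infinity. -/
lemma eq_mul_Eis {k : ℕ} (hk : 3 ≤ k) (hk2 : Even k) (hk' : k < 12) {f : ℂ → ℂ} {L : ℂ}
    (hf : DifferentiableOn ℂ f {τ | 0 < τ.im}) (hT : ∀ τ : ℂ, 0 < τ.im → f (τ + 1) = f τ)
    (hS : ∀ τ : ℂ, 0 < τ.im → f (-1 / τ) = τ ^ k * f τ)
    (hL : Tendsto f (comap im atTop) (𝓝 L)) {τ : ℂ} (hτ : 0 < τ.im) : f τ = L * Eis k τ := by
  have hES : (E hk : ℍ → ℂ) ∣[(k : ℤ)] ModularGroup.S = E hk :=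
    SlashInvariantFormClass.slash_action_eq (E hk) _ ⟨_, rfl⟩
  have hET : (E hk : ℍ → ℂ) ∣[(k : ℤ)] ModularGroup.T = E hk :=
    SlashInvariantFormClass.slash_action_eq (E hk) _ ⟨_, rfl⟩
  set F : ℍ → ℂ := fun τ => f τ
  have hFS : F ∣[(k : ℤ)] ModularGroup.S = F := by
    ext τ
    have hτ0 := ne_zero_of_im_pos τ.im_pos
    rw [ModularForm.SL_slash_apply, ModularGroup.denom_S, UpperHalfPlane.modular_S_smul]
    have := hS τ τ.im_pos
    simp only [F, zpow_neg, zpow_natCast]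
    rw [show (-(τ : ℂ))⁻¹ = -1 / τ by rw [inv_neg, neg_div, one_div], this]
    field_simp
  have hFT : F ∣[(k : ℤ)] ModularGroup.T = F := by
    ext τ
    rw [ModularForm.SL_slash_apply, UpperHalfPlane.modular_T_smul]
    have := hT τ τ.im_pos
    have hd : denom ModularGroup.T τ = 1 := by
      rw [ModularGroup.denom_apply]; simp [ModularGroup.T]
    rw [hd]
    simp [F, add_comm, this]
  have h := eq_zero_of_isZeroAtImInfty (k := k) (F := F + (-L) • ⇑(E hk)) (by exact_mod_cast hk')
    ?_ (by rw [SlashAction.add_slash, ModularForm.SL_smul_slash, hFS, hES])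
    (by rw [SlashAction.add_slash, ModularForm.SL_smul_slash, hFT, hET]) ?_
  · have := congrFun h ⟨τ, hτ⟩
    simp only [F, Pi.add_apply, Pi.smul_apply, smul_eq_mul, Pi.zero_apply, E_eq_Eis hk hk2] at this
    linear_combination this
  · have hF : MDiff F := by
      rw [UpperHalfPlane.mdifferentiable_iff]
      refine hf.congr fun τ hτ => ?_
      simp [F, ofComplex_apply_of_im_pos hτ]
    exact hF.add ((E hk).holo'.const_smul (-L))
  · have hF : Tendsto F atImInfty (𝓝 L) := by
      refine hL.comp ?_
      rw [atImInfty, tendsto_comap_iff]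
      exact tendsto_comap
    have := hF.add ((tendsto_E hk hk2).const_smul (-L))
    rwa [_root_.neg_smul, smul_eq_mul, mul_one, add_neg_cancel] at this

end levelOne

section jacobiTerm

/-- The exponent of the `l`-th term of the summand of `E_{k,1}` attached to `(a b; c d)`. -/
def jacobiPhase (a b c d : ℤ) (τ z : ℂ) (l : ℤ) : ℂ :=
  (l : ℂ) ^ 2 * (a * τ + b) / (c * τ + d) + 2 * l * z / (c * τ + d) - c * z ^ 2 / (c * τ + d)

/-- The summand of `E_{4,1}` attached to the matrix `(a b; c d)`. -/
def jacobiTerm (a b c d : ℤ) (τ z : ℂ) : ℂ :=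
  ((c : ℂ) * τ + d) ^ (-4 : ℤ) * ∑' l : ℤ, e2 (jacobiPhase a b c d τ z l)

variable {a b c d : ℤ} {τ : ℂ}

lemma linear_ne_zero (hτ : 0 < τ.im) (h : a * d - b * c = 1) : (c : ℂ) * τ + d ≠ 0 := by
  intro h0
  have hi : (c : ℝ) * τ.im = 0 := by simpa using congrArg im h0
  have hc : c = 0 := by exact_mod_cast (mul_eq_zero.mp hi).resolve_right hτ.ne'
  subst hc
  have hd : d = 0 := by simpa using h0
  subst hd
  simp at h

lemma jacobiPhase_eq (a b c d : ℤ) (τ z : ℂ) (l : ℤ) : jacobiPhase a b c d τ z l =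
    ((l : ℂ) ^ 2 * (a * τ + b) + 2 * l * z - c * z ^ 2) / (c * τ + d) := by
  rw [jacobiPhase]; ring

lemma jacobiTerm_eq_of_det (hτ : 0 < τ.im) {a' b' : ℤ} (h : a * d - b * c = 1)
    (h' : a' * d - b' * c = 1) (z : ℂ) : jacobiTerm a b c d τ z = jacobiTerm a' b' c d τ z := by
  have hj := linear_ne_zero hτ h
  set t : ℤ := a' * b - a * b' with ht
  have ha : a' = a - t * c := by rw [ht]; linear_combination a * h' - a' * h
  have hb : b' = b - t * d := by rw [ht]; linear_combination b * h' - b' * h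
  rw [jacobiTerm, jacobiTerm]
  congr 1
  refine tsum_congr fun l => ?_
  rw [← e2_add_int (jacobiPhase a' b' c d τ z l) (l ^ 2 * t), ha, hb]
  congr 1
  rw [jacobiPhase_eq, jacobiPhase_eq, div_add' _ _ _ hj]
  congr 1
  push_cast
  ring

lemma EisJSummand_eq_jacobiTerm (hτ : 0 < τ.im) (h : a * d - b * c = 1) (z : ℂ) :
    EisJSummand 4 1 τ z c d = jacobiTerm a b c d τ z := by
  have hb : (bezout c d).1 * d - (bezout c d).2 * c = 1 := by
    have hex : ∃ ab : ℤ × ℤ, ab.1 * d - ab.2 * c = 1 := ⟨(a, b), h⟩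
    rw [bezout, dif_pos hex]
    exact hex.choose_spec
  rw [jacobiTerm_eq_of_det hτ h hb, EisJSummand, jacobiTerm]
  simp only [jacobiPhase, Nat.cast_one, one_mul, Nat.cast_ofNat]

lemma exists_det_eq_one {p : ℤ × ℤ} (hp : IsCoprime p.1 p.2) :
    ∃ a b : ℤ, a * p.2 - b * p.1 = 1 := by
  obtain ⟨u, v, h⟩ := hp
  exact ⟨v, -u, by linear_combination h⟩

lemma jacobiTerm_add_one (hτ : 0 < τ.im) (h : a * d - b * c = 1) (z : ℂ) :
    jacobiTerm a b c d τ (z + 1) = jacobiTerm a b c d τ z := by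
  have hj := linear_ne_zero hτ h
  rw [jacobiTerm, jacobiTerm, ← (Equiv.subRight c).tsum_eq
    (fun l => e2 (jacobiPhase a b c d τ z l))]
  congr 1
  refine tsum_congr fun l => ?_
  rw [Equiv.subRight_apply, ← e2_add_int _ (c * a - 2 * l * a)]
  congr 1
  have h' : (a : ℂ) * d - b * c = 1 := by exact_mod_cast h
  rw [jacobiPhase_eq, jacobiPhase_eq, div_add' _ _ _ hj]
  congr 1
  push_cast
  linear_combination (c - 2 * l) * h'

lemma jacobiTerm_add_period (hτ : 0 < τ.im) (h : a * d - b * c = 1) (z : ℂ) :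
    jacobiTerm a b c d τ (z + τ) = e2 (-τ) * e2 (-(2 * z)) * jacobiTerm a b c d τ z := by
  have hj := linear_ne_zero hτ h
  rw [jacobiTerm, jacobiTerm, ← (Equiv.addRight d).tsum_eq
    (fun l => e2 (jacobiPhase a b c d τ z l)), mul_left_comm, ← tsum_mul_left (a := e2 _ * e2 _)]
  congr 1
  refine tsum_congr fun l => ?_
  rw [Equiv.coe_addRight, ← e2_add, ← e2_add, ← e2_add_int _ (2 * l * b + d * b)]
  congr 1
  have h' : (a : ℂ) * d - b * c = 1 := by exact_mod_cast h
  rw [jacobiPhase_eq, jacobiPhase_eq, div_add' _ _ _ hj, add_div' _ _ _ hj]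
  congr 1
  push_cast
  linear_combination (- 2 * l * τ - d * τ) * h'

lemma im_moebius_pos (hτ : 0 < τ.im) (h : a * d - b * c = 1) :
    0 < ((a * τ + b) / (c * τ + d)).im := by
  have hj := normSq_pos.mpr (linear_ne_zero hτ h)
  have h' : (a : ℝ) * d - b * c = 1 := by exact_mod_cast h
  have : ((a * τ + b) / (c * τ + d)).im = τ.im / normSq (c * τ + d) := by
    rw [div_im]
    simp only [add_im, mul_im, intCast_re, intCast_im, add_re, mul_re, zero_mul, add_zero,
      sub_zero]
    field_simp
    linear_combination h'
  rw [this]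
  positivity

lemma jacobiTerm_eq_jacobiTheta₂ (a b c d : ℤ) (τ z : ℂ) : jacobiTerm a b c d τ z =
    ((c : ℂ) * τ + d) ^ (-4 : ℤ) * (e2 (-(c * z ^ 2 / (c * τ + d))) *
      jacobiTheta₂ (2 * z / (c * τ + d)) (2 * ((a * τ + b) / (c * τ + d)))) := by
  rw [jacobiTerm, jacobiTheta₂, ← tsum_mul_left (a := e2 _)]
  congr 1
  refine tsum_congr fun l => ?_
  rw [jacobiTheta₂_term, e2, e2, ← Complex.exp_add, jacobiPhase]
  congr 1
  ring

lemma jacobiTerm_isThetaFunction (hτ : 0 < τ.im) (h : a * d - b * c = 1) :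
    IsThetaFunction τ 2 (e2 (-τ)) (jacobiTerm a b c d τ) where
  differentiable := by
    have hθ : Differentiable ℂ (jacobiTheta₂ · (2 * ((a * τ + b) / (c * τ + d)))) := fun z =>
      differentiableAt_jacobiTheta₂_fst z (by simpa using im_moebius_pos hτ h)
    rw [funext (jacobiTerm_eq_jacobiTheta₂ a b c d τ)]
    exact (Differentiable.mul (by fun_prop) (hθ.comp (f := fun z => 2 * z / (c * τ + d))
      (by fun_prop))).const_mul _
  add_one := jacobiTerm_add_one hτ h
  add_period z := by exact_mod_cast jacobiTerm_add_period hτ h z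

lemma jacobiTerm_differentiableOn (h : a * d - b * c = 1) (z : ℂ) :
    DifferentiableOn ℂ (fun τ => jacobiTerm a b c d τ z) {τ | 0 < τ.im} := by
  refine DifferentiableOn.congr (f := fun τ : ℂ => ((c : ℂ) * τ + d) ^ (-4 : ℤ) *
    (e2 (-(c * z ^ 2 / (c * τ + d))) *
      jacobiTheta₂ (2 * z / (c * τ + d)) (2 * ((a * τ + b) / (c * τ + d))))) ?_
    fun τ _ => jacobiTerm_eq_jacobiTheta₂ a b c d τ z
  intro τ hτ
  have hj := linear_ne_zero hτ h
  have hl : DifferentiableAt ℂ (fun τ : ℂ => (c : ℂ) * τ + d) τ := by fun_prop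
  have hθ := (hasFDerivAt_jacobiTheta₂ (2 * z / (c * τ + d))
    (τ := 2 * ((a * τ + b) / (c * τ + d)))
    (by simpa using im_moebius_pos hτ h)).differentiableAt
  refine (DifferentiableAt.mul (hl.zpow (Or.inl hj)) (DifferentiableAt.mul ?_
    (DifferentiableAt.comp (f := fun τ : ℂ => (2 * z / (c * τ + d),
      2 * ((a * τ + b) / (c * τ + d)))) τ hθ ?_))).differentiableWithinAt
  · exact differentiable_e2.differentiableAt.comp τ
      (((differentiableAt_const _).div hl hj).neg)
  · exact ((differentiableAt_const _).div hl hj).prodMk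
      (DifferentiableAt.const_mul (DifferentiableAt.div (by fun_prop) hl hj) _)

lemma jacobiTerm_translation (τ z : ℂ) :
    jacobiTerm a b c d (τ + 1) z = jacobiTerm a (a + b) c (c + d) τ z := by
  have h1 : (c : ℂ) * (τ + 1) + d = c * τ + (c + d) := by ring
  have h2 : (a : ℂ) * (τ + 1) + b = a * τ + (a + b) := by ring
  simp only [jacobiTerm, jacobiPhase, Int.cast_add, h1, h2]

lemma jacobiTerm_inversion (hτ : 0 < τ.im) (h : a * d - b * c = 1) (z : ℂ) :
    jacobiTerm a b c d (-1 / τ) (z / τ) =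
      τ ^ 4 * e2 (z ^ 2 / τ) * jacobiTerm b (-a) d (-c) τ z := by
  have h0 := ne_zero_of_im_pos hτ
  have hj : (d : ℂ) * τ + (-c : ℤ) ≠ 0 :=
    linear_ne_zero (a := b) (b := -a) hτ (by linear_combination h)
  have hj' : (c : ℂ) * (-1 / τ) + d = (d * τ + (-c : ℤ)) / τ := by
    push_cast; field_simp; ring
  have hp : ∀ l, e2 (jacobiPhase a b c d (-1 / τ) (z / τ) l) =
      e2 (z ^ 2 / τ) * e2 (jacobiPhase b (-a) d (-c) τ z l) := fun l => by
    rw [← e2_add, jacobiPhase_eq, jacobiPhase_eq, hj', add_div' _ _ _ hj, div_div_eq_mul_div]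
    congr 2
    push_cast
    field_simp
    ring
  simp_rw [jacobiTerm, hj', div_zpow, hp]
  rw [_root_.tsum_mul_left, zpow_neg τ, div_inv_eq_mul, zpow_ofNat]
  ring

end jacobiTerm

section bound

variable {a b c d : ℤ} {τ : ℂ}

lemma summable_exp_neg_sq_sub {t : ℝ} (ht : 0 < t) (s : ℝ) :
    Summable fun l : ℤ => Real.exp (-(2 * Real.pi * (t * (l - s) ^ 2))) := by
  have h := ((summable_jacobiTheta₂_term_iff ((-(2 * t * s) : ℝ) * I) ((2 * t : ℝ) * I)).mpr
    (by simpa using ht)).norm.mul_left (Real.exp (-(2 * Real.pi * (t * s ^ 2))))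
  refine h.congr fun l => ?_
  rw [norm_jacobiTheta₂_term, ← Real.exp_add]
  simp only [im_ofReal_mul, I_im, mul_one]
  ring_nf

lemma tsum_exp_neg_sq_sub_le {t : ℝ} (ht : 0 < t) (s : ℝ) :
    ∑' l : ℤ, Real.exp (-(2 * Real.pi * (t * (l - s) ^ 2))) ≤
      (√(2 * t))⁻¹ * ∑' l : ℤ, Real.exp (-Real.pi * l ^ 2 * (2 * t)⁻¹) := by
  have h2 : 0 < 2 * t := by positivity
  have hnorm : ∀ l : ℤ, ‖cexp (-Real.pi / (2 * t : ℝ) * (l + I * (2 * t * s : ℝ)) ^ 2)‖ =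
      Real.exp (2 * Real.pi * (t * s ^ 2)) * Real.exp (-Real.pi * l ^ 2 * (2 * t)⁻¹) := by
    intro l
    have he : (-Real.pi / (2 * t : ℝ) * (l + I * (2 * t * s : ℝ)) ^ 2 : ℂ) =
        (2 * Real.pi * (t * s ^ 2) + -Real.pi * l ^ 2 * (2 * t)⁻¹ : ℝ) +
          (-(2 * Real.pi * l * s) : ℝ) * I := by
      have : (t : ℂ) ≠ 0 := by exact_mod_cast ht.ne'
      push_cast
      field_simp
      linear_combination (-4 * t ^ 2 * s ^ 2) * I_sq
    rw [Complex.norm_exp, he, add_re, ofReal_re, re_ofReal_mul, I_re, mul_zero, add_zero,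
      Real.exp_add]
  have hS := (summable_exp_neg_sq (inv_pos.mpr h2)).mul_left (Real.exp (2 * Real.pi * (t * s ^ 2)))
  have hq := Complex.tsum_exp_neg_quadratic (a := (2 * t : ℝ)) (by simpa using ht)
    (2 * t * s : ℝ)
  have hn : (∑' l : ℤ, Real.exp (-(2 * Real.pi * (t * (l - s) ^ 2)))) =
      Real.exp (-(2 * Real.pi * (t * s ^ 2))) *
        ‖∑' l : ℤ, cexp (-Real.pi * (2 * t : ℝ) * l ^ 2 + 2 * Real.pi * (2 * t * s : ℝ) * l)‖ := by
    have : ∀ l : ℤ, cexp (-Real.pi * (2 * t : ℝ) * l ^ 2 + 2 * Real.pi * (2 * t * s : ℝ) * l) =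
        (Real.exp (2 * Real.pi * (t * s ^ 2)) *
          Real.exp (-(2 * Real.pi * (t * (l - s) ^ 2))) : ℝ) := fun l => by
      rw [← Real.exp_add]
      push_cast
      ring_nf
    simp_rw [this]
    rw [← ofReal_tsum, norm_real, tsum_mul_left, norm_mul, Real.norm_of_nonneg (by positivity),
      Real.norm_of_nonneg (tsum_nonneg fun _ => by positivity), ← mul_assoc, ← Real.exp_add,
      neg_add_cancel, Real.exp_zero, one_mul]
  rw [hn, hq, norm_mul, norm_div, norm_one, norm_cpow_eq_rpow_re_of_pos h2, one_div,
    show ((1 / 2 : ℂ)).re = 1 / 2 by norm_num, ← Real.sqrt_eq_rpow, mul_left_comm]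
  gcongr
  refine (mul_le_mul_of_nonneg_left (norm_tsum_le_tsum_norm (by simpa only [hnorm] using hS))
    (by positivity)).trans_eq ?_
  simp_rw [hnorm]
  rw [tsum_mul_left, ← mul_assoc, ← Real.exp_add, neg_add_cancel, Real.exp_zero, one_mul]

lemma norm_e2_jacobiPhase (hτ : 0 < τ.im) (h : a * d - b * c = 1) (x : ℝ) (l : ℤ) :
    ‖e2 (jacobiPhase a b c d τ x l)‖ =
      Real.exp (-(2 * Real.pi * (τ.im / normSq (c * τ + d) * (l - c * x) ^ 2))) := by
  have hj := normSq_pos.mpr (linear_ne_zero hτ h)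
  have h' : (a : ℝ) * d - b * c = 1 := by exact_mod_cast h
  rw [norm_e2, jacobiPhase_eq, div_im]
  congr 3
  simp only [add_im, sub_im, mul_im, mul_re, add_re, sub_re, intCast_re, intCast_im, ofReal_re,
    ofReal_im, pow_two, re_ofNat, im_ofNat]
  field_simp
  linear_combination (l ^ 2 * τ.im) * h'

lemma summable_e2_jacobiPhase (hτ : 0 < τ.im) (h : a * d - b * c = 1) (x : ℝ) :
    Summable fun l => ‖e2 (jacobiPhase a b c d τ x l)‖ := by
  simp_rw [norm_e2_jacobiPhase hτ h]
  exact summable_exp_neg_sq_sub (div_pos hτ (normSq_pos.mpr (linear_ne_zero hτ h))) _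

lemma exists_norm_jacobiTerm_le {B : ℝ} (hB : 0 < B) : ∃ K : ℝ, 0 ≤ K ∧
    ∀ (a b c d : ℤ) (τ : ℂ) (x : ℝ), a * d - b * c = 1 → B ≤ τ.im →
      ‖jacobiTerm a b c d τ x‖ ≤ K * ‖(c : ℂ) * τ + d‖ ^ (-3 : ℤ) := by
  set K₁ := ∑' l : ℤ, Real.exp (-(2 * Real.pi * (B * (l - 0) ^ 2)))
  set K₂ := (√(2 * B))⁻¹ * ∑' l : ℤ, Real.exp (-Real.pi * l ^ 2 * (B / 2))
  have hK₁ : 0 ≤ K₁ := tsum_nonneg fun _ => by positivity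
  have hK₂ : 0 ≤ K₂ := mul_nonneg (by positivity) (tsum_nonneg fun _ => by positivity)
  refine ⟨K₁ + K₂, by positivity, fun a b c d τ x h hy => ?_⟩
  have hτ : 0 < τ.im := hB.trans_le hy
  have hj0 := linear_ne_zero hτ h
  have hj : 0 < ‖(c : ℂ) * τ + d‖ := norm_pos_iff.mpr hj0
  set j := ‖(c : ℂ) * τ + d‖ with hjdef
  have hπ := Real.pi_pos
  suffices hs : ∑' l, ‖e2 (jacobiPhase a b c d τ x l)‖ ≤ (K₁ + K₂) * j by
    rw [jacobiTerm, norm_mul, norm_zpow]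
    calc j ^ (-4 : ℤ) * ‖∑' l, e2 (jacobiPhase a b c d τ x l)‖
        ≤ j ^ (-4 : ℤ) * ((K₁ + K₂) * j) := by
          gcongr
          exact (norm_tsum_le_tsum_norm (summable_e2_jacobiPhase hτ h x)).trans hs
      _ = (K₁ + K₂) * j ^ (-3 : ℤ) := by
          rw [show (-3 : ℤ) = -4 + 1 by norm_num, zpow_add_one₀ hj.ne']; ring
  simp_rw [norm_e2_jacobiPhase hτ h, normSq_eq_norm_sq, ← hjdef]
  rcases eq_or_ne c 0 with rfl | hc
  · have hj1 : j = 1 := by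
      have hd : IsUnit d := IsUnit.of_mul_eq_one a (by linear_combination h)
      rcases Int.isUnit_iff.mp hd with rfl | rfl <;> simp [hjdef]
    rw [hj1, mul_one]
    refine le_add_of_le_of_nonneg ((summable_exp_neg_sq_sub (t := τ.im / 1 ^ 2)
      (by simpa using hτ) _).tsum_le_tsum (fun l => ?_) (summable_exp_neg_sq_sub hB 0)) hK₂
    rw [Int.cast_zero, zero_mul, one_pow, div_one]
    gcongr
  · have hcy : τ.im ≤ j := by
      have h1 : |(c : ℝ) * τ.im| ≤ j := by
        simpa using abs_im_le_norm ((c : ℂ) * τ + d)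
      rw [abs_mul, abs_of_pos hτ] at h1
      have h2 : (1 : ℝ) ≤ |(c : ℝ)| := by exact_mod_cast Int.one_le_abs hc
      nlinarith
    have ht : 0 < τ.im / j ^ 2 := by positivity
    have htB : B / 2 ≤ (2 * (τ.im / j ^ 2))⁻¹ := by
      rw [mul_inv, inv_div, div_eq_inv_mul]
      gcongr
      rw [le_div_iff₀ hτ]
      nlinarith
    refine (tsum_exp_neg_sq_sub_le ht _).trans ?_
    have h1 : (√(2 * (τ.im / j ^ 2)))⁻¹ ≤ (√(2 * B))⁻¹ * j := by
      rw [← mul_div_assoc, Real.sqrt_div (by positivity), Real.sqrt_sq hj.le, inv_div,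
        div_eq_inv_mul]
      gcongr
    have h2 : ∑' l : ℤ, Real.exp (-Real.pi * l ^ 2 * (2 * (τ.im / j ^ 2))⁻¹) ≤
        ∑' l : ℤ, Real.exp (-Real.pi * l ^ 2 * (B / 2)) := by
      refine (summable_exp_neg_sq (by positivity)).tsum_le_tsum (fun l => ?_)
        (summable_exp_neg_sq (by positivity))
      simp only [Real.exp_le_exp, neg_mul, neg_le_neg_iff]
      gcongr
    calc _ ≤ (√(2 * B))⁻¹ * j * ∑' l : ℤ, Real.exp (-Real.pi * l ^ 2 * (B / 2)) :=
          mul_le_mul h1 h2 (tsum_nonneg fun _ => by positivity) (by positivity)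
      _ = K₂ * j := by ring
      _ ≤ _ := by gcongr; linarith

end bound

section EisJ

open Filter Topology

variable {τ : ℂ}

/-- A summable majorant for the series defining `E_{4,1}` at real `z`, uniform in vertical
strips. -/
lemma exists_summable_norm_EisJSummand_le (A : ℝ) {B : ℝ} (hB : 0 < B) :
    ∃ u : {p : ℤ × ℤ // IsCoprime p.1 p.2} → ℝ, Summable u ∧
      ∀ (p : {p : ℤ × ℤ // IsCoprime p.1 p.2}) (τ : ℂ) (x : ℝ), |τ.re| ≤ A → B ≤ τ.im →
        ‖EisJSummand 4 1 τ x p.1.1 p.1.2‖ ≤ u p := by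
  obtain ⟨K, hK, hle⟩ := exists_norm_jacobiTerm_le hB
  set v : {p : ℤ × ℤ // IsCoprime p.1 p.2} → Fin 2 → ℤ := fun p => ![p.1.1, p.1.2]
  have hv : Function.Injective v := fun p q hpq => by
    have h0 := congrFun hpq 0
    have h1 := congrFun hpq 1
    exact Subtype.ext (Prod.ext h0 h1)
  have hs := (EisensteinSeries.summable_one_div_norm_rpow (k := 3) (by norm_num)).comp_injective hv
  refine ⟨fun p => K * (EisensteinSeries.r ⟨⟨A, B⟩, hB⟩ ^ (-3 : ℝ) * ‖v p‖ ^ (-3 : ℝ)),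
    (hs.mul_left _).mul_left _, fun p τ x hA hy => ?_⟩
  have hτ : 0 < τ.im := hB.trans_le hy
  obtain ⟨a, b, h⟩ := exists_det_eq_one p.2
  rw [EisJSummand_eq_jacobiTerm hτ h]
  refine (hle a b _ _ τ x h hy).trans (mul_le_mul_of_nonneg_left ?_ hK)
  have := EisensteinSeries.summand_bound_of_mem_verticalStrip (z := ⟨τ, hτ⟩) (k := 3)
    (by norm_num) (v p) hB ⟨hA, hy⟩
  rw [← Real.rpow_intCast]
  exact_mod_cast this

lemma summable_EisJSummand (hτ : 0 < τ.im) (x : ℝ) :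
    Summable fun p : {p : ℤ × ℤ // IsCoprime p.1 p.2} => EisJSummand 4 1 τ x p.1.1 p.1.2 := by
  obtain ⟨u, hu, hle⟩ := exists_summable_norm_EisJSummand_le |τ.re| hτ
  exact .of_norm_bounded hu fun p => hle p τ x le_rfl le_rfl

lemma differentiableOn_EisJ (x : ℝ) :
    DifferentiableOn ℂ (fun τ => EisJ 4 1 τ x) {τ | 0 < τ.im} := by
  intro τ hτ
  have hτ' : 0 < τ.im := hτ
  set U : Set ℂ := {w | |w.re| < |τ.re| + 1} ∩ {w | τ.im / 2 < w.im}
  have hU : IsOpen U := (isOpen_lt (by fun_prop) continuous_const).inter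
    (isOpen_lt continuous_const (by fun_prop))
  obtain ⟨u, hu, hle⟩ := exists_summable_norm_EisJSummand_le (|τ.re| + 1) (half_pos hτ')
  have hd := differentiableOn_tsum_of_summable_norm (U := U)
    (F := fun (p : {p : ℤ × ℤ // IsCoprime p.1 p.2}) τ => EisJSummand 4 1 τ x p.1.1 p.1.2) hu
    (fun p => ?_) hU (fun p w hw => hle p w x hw.1.le hw.2.le)
  · refine ((hd.differentiableAt (hU.mem_nhds ⟨?_, ?_⟩)).const_mul (1 / 2)).differentiableWithinAt
    · exact lt_add_one |τ.re|
    · exact half_lt_self hτ'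
  · obtain ⟨a, b, h⟩ := exists_det_eq_one p.2
    have hpos : ∀ w ∈ U, 0 < w.im := fun w hw => (half_pos hτ').trans hw.2
    exact ((jacobiTerm_differentiableOn h (x : ℂ)).mono hpos).congr
      fun w hw => EisJSummand_eq_jacobiTerm (hpos w hw) h _

lemma EisJ_add_one (hτ : 0 < τ.im) (z : ℂ) : EisJ 4 1 (τ + 1) z = EisJ 4 1 τ z := by
  let e : {p : ℤ × ℤ // IsCoprime p.1 p.2} ≃ {p : ℤ × ℤ // IsCoprime p.1 p.2} :=
    { toFun := fun p => ⟨(p.1.1, p.1.1 + p.1.2), by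
        simpa [add_comm] using IsCoprime.add_mul_left_right p.2 1⟩
      invFun := fun p => ⟨(p.1.1, p.1.2 - p.1.1), by
        simpa [sub_eq_add_neg] using (IsCoprime.add_mul_left_right p.2 (-1))⟩
      left_inv := fun p => by simp
      right_inv := fun p => by simp }
  rw [EisJ, EisJ, ← e.tsum_eq (fun p => EisJSummand 4 1 τ z p.1.1 p.1.2)]
  congr 1
  refine tsum_congr fun p => ?_
  obtain ⟨a, b, h⟩ := exists_det_eq_one p.2
  rw [EisJSummand_eq_jacobiTerm (by simpa using hτ) h, jacobiTerm_translation]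
  exact (EisJSummand_eq_jacobiTerm hτ (by linear_combination h) z).symm

lemma EisJ_inversion (hτ : 0 < τ.im) (z : ℂ) :
    EisJ 4 1 (-1 / τ) (z / τ) = τ ^ 4 * e2 (z ^ 2 / τ) * EisJ 4 1 τ z := by
  let e : {p : ℤ × ℤ // IsCoprime p.1 p.2} ≃ {p : ℤ × ℤ // IsCoprime p.1 p.2} :=
    { toFun := fun p => ⟨(p.1.2, -p.1.1), p.2.symm.neg_right⟩
      invFun := fun p => ⟨(-p.1.2, p.1.1), p.2.symm.neg_left⟩
      left_inv := fun p => by simp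
      right_inv := fun p => by simp }
  rw [EisJ, EisJ, ← e.tsum_eq (fun p => EisJSummand 4 1 τ z p.1.1 p.1.2), mul_left_comm,
    ← tsum_mul_left (a := τ ^ 4 * e2 (z ^ 2 / τ))]
  congr 1
  refine tsum_congr fun p => ?_
  obtain ⟨a, b, h⟩ := exists_det_eq_one p.2
  rw [EisJSummand_eq_jacobiTerm (neg_one_div_im_pos hτ) h, jacobiTerm_inversion hτ h]
  congr 1
  exact (EisJSummand_eq_jacobiTerm hτ (by linear_combination h) z).symm

lemma tendsto_comap_im_of_periodic {f : ℂ → ℂ} {L : ℂ}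
    (hf : ∀ τ : ℂ, 0 < τ.im → f (τ + 1) = f τ)
    (h : Tendsto f (comap im atTop ⊓ 𝓟 {τ | |τ.re| ≤ 1}) (𝓝 L)) :
    Tendsto f (comap im atTop) (𝓝 L) := by
  have hf' : ∀ (n : ℤ) (τ : ℂ), 0 < τ.im → f (τ + n) = f τ := by
    intro n
    induction n with
    | zero => simp
    | succ n ih =>
      intro τ hτ
      push_cast at ih ⊢
      rw [← add_assoc, hf _ (by simpa using hτ), ih τ hτ]
    | pred n ih =>
      intro τ hτ
      push_cast at ih ⊢
      rw [← hf _ (by simpa using hτ), ← ih τ hτ]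
      ring_nf
  have ht : Tendsto (fun τ : ℂ => τ + (-⌊τ.re⌋ : ℤ)) (comap im atTop)
      (comap im atTop ⊓ 𝓟 {τ | |τ.re| ≤ 1}) := by
    refine tendsto_inf.mpr ⟨tendsto_comap_iff.mpr (tendsto_comap.congr fun τ => ?_),
      tendsto_principal.mpr (Eventually.of_forall fun τ => ?_)⟩
    · simp
    · have h0 := Int.fract_nonneg τ.re
      have h1 := Int.fract_lt_one τ.re
      have : (τ + (-⌊τ.re⌋ : ℤ)).re = Int.fract τ.re := by
        simp [Int.fract, sub_eq_add_neg]
      rw [Set.mem_ofPred_eq, this, abs_of_nonneg h0]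
      exact h1.le
  refine (h.comp ht).congr' ?_
  filter_upwards [eventually_im_ge 1] with τ hτ
  exact hf' _ τ (by linarith)

lemma jacobiTerm_of_isUnit {d : ℤ} (hd : IsUnit d) (z : ℂ) :
    jacobiTerm d 0 0 d τ z = jacobiTheta₂ (2 * z / d) (2 * τ) := by
  rw [jacobiTerm_eq_jacobiTheta₂]
  rcases Int.isUnit_iff.mp hd with rfl | rfl <;> norm_num

lemma tendsto_EisJSummand (x : ℝ) {p : ℤ × ℤ} (hp : IsCoprime p.1 p.2) :
    Tendsto (fun τ => EisJSummand 4 1 τ x p.1 p.2) (comap im atTop)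
      (𝓝 (if p.1 = 0 then 1 else 0)) := by
  obtain ⟨c, d⟩ := p
  have hpos : ∀ᶠ τ in comap im atTop, 0 < τ.im :=
    (eventually_im_ge 1).mono fun τ hτ => by linarith
  split_ifs with hc
  · simp only at hc hp
    subst hc
    have hd : IsUnit d := isCoprime_zero_left.mp hp
    have ht : Tendsto (fun τ : ℂ => 2 * τ) (comap im atTop) (comap im atTop) := by
      refine tendsto_comap_iff.mpr ((tendsto_comap.const_mul_atTop two_pos).congr fun τ => ?_)
      simp
    refine ((tendsto_jacobiTheta₂ (2 * x / d)).comp ht).congr' ?_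
    filter_upwards [hpos] with τ hτ
    rw [EisJSummand_eq_jacobiTerm (a := d) (b := 0) hτ, jacobiTerm_of_isUnit hd]
    · simp
    · rcases Int.isUnit_iff.mp hd with rfl | rfl <;> norm_num
  · obtain ⟨a, b, h⟩ := exists_det_eq_one hp
    obtain ⟨K, hK, hle⟩ := exists_norm_jacobiTerm_le one_pos
    have h0 : Tendsto (fun τ : ℂ => K * τ.im ^ (-3 : ℤ)) (comap im atTop) (𝓝 0) := by
      simpa using ((tendsto_zpow_atTop_zero (𝕜 := ℝ) (n := -3) (by norm_num)).comp
        tendsto_comap).const_mul K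
    refine squeeze_zero_norm' ?_ h0
    filter_upwards [eventually_im_ge 1] with τ hy
    have hτ : 0 < τ.im := by linarith
    rw [EisJSummand_eq_jacobiTerm hτ h]
    refine (hle a b c d τ x h hy).trans (mul_le_mul_of_nonneg_left ?_ hK)
    have h1 : |(c : ℝ) * τ.im| ≤ ‖(c : ℂ) * τ + d‖ := by
      simpa using abs_im_le_norm ((c : ℂ) * τ + d)
    rw [abs_mul, abs_of_pos hτ] at h1
    have h2 : (1 : ℝ) ≤ |(c : ℝ)| := by exact_mod_cast Int.one_le_abs hc
    have h3 : τ.im ≤ ‖(c : ℂ) * τ + d‖ := by nlinarith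
    rw [zpow_neg, zpow_neg]
    exact inv_anti₀ (by positivity) (zpow_le_zpow_left₀ (by norm_num) hτ.le h3)

lemma tendsto_EisJ (x : ℝ) : Tendsto (fun τ => EisJ 4 1 τ x) (comap im atTop) (𝓝 1) := by
  refine tendsto_comap_im_of_periodic (fun τ hτ => EisJ_add_one hτ x) ?_
  obtain ⟨u, hu, hle⟩ := exists_summable_norm_EisJSummand_le 1 one_pos
  have h := tendsto_tsum_of_dominated_convergence
    (𝓕 := comap im atTop ⊓ 𝓟 {τ | |τ.re| ≤ 1}) hu
    (f := fun τ (p : {p : ℤ × ℤ // IsCoprime p.1 p.2}) => EisJSummand 4 1 τ x p.1.1 p.1.2)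
    (fun p => (tendsto_EisJSummand x p.2).mono_left inf_le_left) ?_
  · have hsum : ∑' p : {p : ℤ × ℤ // IsCoprime p.1 p.2}, (if p.1.1 = 0 then 1 else 0 : ℂ) = 2 := by
      rw [tsum_eq_sum (s := {⟨(0, 1), isCoprime_one_right⟩,
        ⟨(0, -1), isCoprime_one_right.neg_right⟩})]
      · rw [Finset.sum_pair (by simp)]
        norm_num
      · rintro ⟨⟨c, d⟩, hp⟩ hn
        refine if_neg fun hc => hn ?_
        simp only at hc hp
        subst hc
        rcases Int.isUnit_iff.mp (isCoprime_zero_left.mp hp) with rfl | rfl <;> simp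
    rw [hsum] at h
    have := h.const_mul (1 / 2)
    norm_num only at this
    simpa only [EisJ, one_div] using this
  · filter_upwards [(eventually_im_ge 1).filter_mono inf_le_left,
      mem_inf_of_right (mem_principal_self _)] with τ hy hx p
    exact hle p τ x hx hy

end EisJ

section main

open Filter Topology

variable {τ : ℂ}

lemma EisJ_zero (hτ : 0 < τ.im) : EisJ 4 1 τ 0 = Eis 4 τ := by
  have h := eq_mul_Eis (k := 4) (by norm_num) (by decide) (by norm_num) (L := 1)
    (differentiableOn_EisJ 0) (fun τ hτ => EisJ_add_one hτ _) (fun τ hτ => ?_) (tendsto_EisJ 0) hτ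
  · simpa using h
  · have := EisJ_inversion hτ 0
    simpa using this

lemma IsThetaFunction.eq_interpolation (hτ : 0 < τ.im) {f : ℂ → ℂ}
    (hf : IsThetaFunction τ 2 (e2 (-τ)) f) (z : ℂ) :
    f z = f 0 * xi10 τ z ^ 2 + f (1 / 2) * (phiM21 τ z / phiM21 τ (1 / 2)) := by
  have hu := xi10_sq_isThetaFunction hτ
  have hv := phiM21_isThetaFunction hτ
  have hv0 := phiM21_half_ne_zero hτ
  have h := ((hf.linearComb hu 1 (-f 0)).linearComb hv 1
    (-(f (1 / 2) / phiM21 τ (1 / 2)))).eq_zero_of_two hu hv (e2_ne_zero _) (p := 0) (r := 1 / 2)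
    (by simp only [xi10_zero hτ, phiM21_zero]; ring)
    (by simp only [xi10_half hτ]; field_simp; ring)
    (by simp [xi10_zero hτ]) (by simp only [xi10_half hτ]; simp) phiM21_zero hv0
  have := congrFun h z
  simp only [Pi.zero_apply] at this
  linear_combination this

lemma EisJ_eq_interpolation (hτ : 0 < τ.im) (z : ℂ) : EisJ 4 1 τ z =
    EisJ 4 1 τ 0 * xi10 τ z ^ 2 + EisJ 4 1 τ (1 / 2) * (phiM21 τ z / phiM21 τ (1 / 2)) := by
  have h0 := summable_EisJSummand hτ 0
  have h1 := summable_EisJSummand hτ (1 / 2)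
  push_cast at h0 h1
  have hp : ∀ p : {p : ℤ × ℤ // IsCoprime p.1 p.2}, EisJSummand 4 1 τ z p.1.1 p.1.2 =
      EisJSummand 4 1 τ 0 p.1.1 p.1.2 * xi10 τ z ^ 2 +
        EisJSummand 4 1 τ (1 / 2) p.1.1 p.1.2 * (phiM21 τ z / phiM21 τ (1 / 2)) := fun p => by
    obtain ⟨a, b, h⟩ := exists_det_eq_one p.2
    simp only [EisJSummand_eq_jacobiTerm hτ h]
    exact (jacobiTerm_isThetaFunction hτ h).eq_interpolation hτ z
  simp only [EisJ]
  rw [tsum_congr hp, (h0.mul_right _).tsum_add (h1.mul_right _), tsum_mul_right, tsum_mul_right]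
  ring

/-- The coefficient of `φ_{-2,1}` in the expansion of `12 E_{4,1}` in `φ_{0,1}` and
`φ_{-2,1}`. -/
def phiM21Coeff (τ : ℂ) : ℂ :=
  (12 * EisJ 4 1 τ (1 / 2) - EisJ 4 1 τ 0 * phi01 τ (1 / 2)) / phiM21 τ (1 / 2)

lemma twelve_EisJ (hτ : 0 < τ.im) (z : ℂ) : 12 * EisJ 4 1 τ z =
    EisJ 4 1 τ 0 * phi01 τ z + phiM21Coeff τ * phiM21 τ z := by
  have h := (phi01_isThetaFunction hτ).eq_interpolation hτ z
  have hv0 := phiM21_half_ne_zero hτ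
  rw [phi01_zero hτ] at h
  rw [EisJ_eq_interpolation hτ z, phiM21Coeff, h]
  field_simp
  ring

lemma phiM21Coeff_add_one (hτ : 0 < τ.im) : phiM21Coeff (τ + 1) = phiM21Coeff τ := by
  simp only [phiM21Coeff, EisJ_add_one hτ, phi01_add_one, phiM21_add_one hτ]

lemma phiM21Coeff_inversion (hτ : 0 < τ.im) :
    phiM21Coeff (-1 / τ) = τ ^ 6 * phiM21Coeff τ := by
  have hne := ne_zero_of_im_pos hτ
  have hv0 := phiM21_half_ne_zero hτ
  have hφ := phiM21_inversion hτ (xi10_sq_isThetaFunction hτ) (by simp [xi10_zero hτ])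
    (by simp only [xi10_half hτ]; simp) (1 / 2)
  have h := twelve_EisJ (neg_one_div_im_pos hτ) (1 / 2 / τ)
  have h0 : EisJ 4 1 (-1 / τ) 0 = τ ^ 4 * EisJ 4 1 τ 0 := by
    simpa using EisJ_inversion hτ 0
  have hz := twelve_EisJ hτ (1 / 2)
  rw [EisJ_inversion hτ, phi01_inversion hτ, h0] at h
  rw [e2_neg, inv_mul_eq_iff_eq_mul₀ (e2_ne_zero _)] at hφ
  rw [hφ] at h
  have he := e2_ne_zero ((1 / 2) ^ 2 / τ)
  have h' : phiM21Coeff (-1 / τ) * ((τ ^ 2)⁻¹ * phiM21 τ (1 / 2)) =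
      τ ^ 4 * (phiM21Coeff τ * phiM21 τ (1 / 2)) := by
    refine mul_left_cancel₀ he ?_
    linear_combination -h + τ ^ 4 * e2 ((1 / 2) ^ 2 / τ) * hz
  field_simp at h'
  rwa [neg_div]

lemma differentiableOn_phiM21Coeff : DifferentiableOn ℂ phiM21Coeff {τ | 0 < τ.im} := by
  have h0 := differentiableOn_EisJ 0
  have h1 := differentiableOn_EisJ (1 / 2)
  push_cast at h0 h1
  exact ((h1.const_mul 12).sub (h0.mul differentiableOn_phi01_half)).div
    differentiableOn_phiM21_half fun τ hτ => phiM21_half_ne_zero hτ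

lemma tendsto_phiM21Coeff : Tendsto phiM21Coeff (comap im atTop) (𝓝 (-1)) := by
  have h0 := tendsto_EisJ 0
  have h1 := tendsto_EisJ (1 / 2)
  push_cast at h0 h1
  have h := ((h1.const_mul 12).sub (h0.mul tendsto_phi01_half)).div tendsto_phiM21_half
    (by norm_num)
  norm_num only at h
  exact h

lemma phiM21Coeff_eq (hτ : 0 < τ.im) : phiM21Coeff τ = -Eis 6 τ := by
  rw [eq_mul_Eis (k := 6) (by norm_num) (by decide) (by norm_num) differentiableOn_phiM21Coeff
    (fun τ hτ => phiM21Coeff_add_one hτ) (fun τ hτ => phiM21Coeff_inversion hτ)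
    tendsto_phiM21Coeff hτ, neg_one_mul]

end main

/-- `12 E_{4,1} = E₄ φ_{0,1} - E₆ φ_{-2,1}` on `ℍ × ℂ`. -/
theorem twelve_E41 (τ z : ℂ) (hτ : 0 < τ.im) :
    12 * EisJ 4 1 τ z = Eis 4 τ * phi01 τ z - Eis 6 τ * phiM21 τ z := by
  rw [twelve_EisJ hτ, EisJ_zero hτ, phiM21Coeff_eq hτ]
  ring

end JacobiPaper
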